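/- O_{1,4}(ℚ) = ℚ[g_{1,4}, g_{1,4}⁻¹, (g_{1,4} − 16)⁻¹]; that is, the ring of weakly holomorphic modular functions for Γ₁(4) with rational Fourier coefficients is generated over ℚ by g_{1,4}(τ), its reciprocal, and the reciprocal of g_{1,4}(τ) − 16. -/

import Mathlib

noncomputable section

open Complex Matrix UpperHalfPlane MatrixGroups

abbrev SL2Z := Matrix.SpecialLinearGroup (Fin 2) ℤ

/-- `e2pi z = exp(2πiz)`. -/
def e2pi (z : ℂ) : ℂ := Complex.exp (2 * Real.pi * Complex.I * z)

/-- `qpow τ x = q^x = exp(2πixτ)`. -/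
def qpow (τ : ℍ) (x : ℂ) : ℂ := Complex.exp (2 * Real.pi * Complex.I * x * τ)

/-- The lattice point `mτ + n` for `p = (m, n)`. -/
def latticePt (τ : ℍ) (p : ℤ × ℤ) : ℂ := (p.1 : ℂ) * τ + (p.2 : ℂ)

/-- Weierstrass invariant `g₂` of the lattice `[τ, 1]`. -/
def g2fun (τ : ℍ) : ℂ := 60 * ∑' p : {p : ℤ × ℤ // p ≠ 0}, (latticePt τ p.1)⁻¹ ^ 4

/-- Weierstrass invariant `g₃` of the lattice `[τ, 1]`. -/
def g3fun (τ : ℍ) : ℂ := 140 * ∑' p : {p : ℤ × ℤ // p ≠ 0}, (latticePt τ p.1)⁻¹ ^ 6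

/-- The discriminant `Δ = g₂³ - 27g₃²`. -/
def deltaFun (τ : ℍ) : ℂ := g2fun τ ^ 3 - 27 * g3fun τ ^ 2

/-- The elliptic modular function `j = 1728 g₂³/Δ`. -/
def jfun (τ : ℍ) : ℂ := 1728 * g2fun τ ^ 3 / deltaFun τ

/-- The Weierstrass `℘`-function of the lattice `[τ, 1]`. -/
def wpfun (τ : ℍ) (z : ℂ) : ℂ :=
  z⁻¹ ^ 2 + ∑' p : {p : ℤ × ℤ // p ≠ 0},
    ((z - latticePt τ p.1)⁻¹ ^ 2 - (latticePt τ p.1)⁻¹ ^ 2)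

/-- The Fricke function `f_v = -2⁷3⁵ (g₂g₃/Δ) ℘(v₁τ + v₂)`. -/
def fricke (v : ℚ × ℚ) (τ : ℍ) : ℂ :=
  -(2 ^ 7 * 3 ^ 5 : ℂ) * g2fun τ * g3fun τ / deltaFun τ *
    wpfun τ ((v.1 : ℂ) * τ + (v.2 : ℂ))

/-- The Siegel function `g_v`, via its `q`-product expansion. -/
def siegel (v : ℚ × ℚ) (τ : ℍ) : ℂ :=
  -Complex.exp (Real.pi * Complex.I * (v.2 : ℂ) * ((v.1 : ℂ) - 1)) *
    qpow τ (((v.1 : ℂ) ^ 2 - (v.1 : ℂ) + 1 / 6) / 2) *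
    (1 - qpow τ (v.1 : ℂ) * e2pi (v.2 : ℂ)) *
    ∏' n : ℕ,
      ((1 - qpow τ ((n : ℂ) + 1 + (v.1 : ℂ)) * e2pi (v.2 : ℂ)) *
       (1 - qpow τ ((n : ℂ) + 1 - (v.1 : ℂ)) * e2pi (-(v.2 : ℂ))))

/-- Extend a function on `ℍ` to `ℂ` by junk values. -/
def asComplexFun (h : ℍ → ℂ) : ℂ → ℂ :=
  fun z => if hz : 0 < z.im then h ⟨z, hz⟩ else 0

/-- `h` is holomorphic on `ℍ`. -/
def IsHoloOnH (h : ℍ → ℂ) : Prop :=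
  DifferentiableOn ℂ (asComplexFun h) {z : ℂ | 0 < z.im}

/-- `h` is meromorphic on `ℍ`. -/
def IsMeromOnH (h : ℍ → ℂ) : Prop :=
  MeromorphicOn (asComplexFun h) {z : ℂ | 0 < z.im}

/-- `v ∈ V_N`: `v = (a/N, b/N)` with `gcd(a, b, N) = 1`. -/
def InVN (N : ℕ) (v : ℚ × ℚ) : Prop :=
  ∃ a b : ℤ, v.1 = (a : ℚ) / (N : ℚ) ∧ v.2 = (b : ℚ) / (N : ℚ) ∧
    Int.gcd a (Int.gcd b (N : ℤ)) = 1

/-- `v ∈ ℤ²`. -/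
def IsIntPair (v : ℚ × ℚ) : Prop := ∃ m n : ℤ, v.1 = (m : ℚ) ∧ v.2 = (n : ℚ)

/-- `u ≡ v (mod ℤ²)`. -/
def EqModZ2 (u v : ℚ × ℚ) : Prop := IsIntPair (u.1 - v.1, u.2 - v.2)

/-- `u ≡ ±v (mod ℤ²)`. -/
def PMEquiv (u v : ℚ × ℚ) : Prop := EqModZ2 u v ∨ EqModZ2 u (-v.1, -v.2)

/-- The action `v ↦ ᵗγ·v` of a matrix on a rational pair. -/
def tAct (γ : Matrix (Fin 2) (Fin 2) ℤ) (v : ℚ × ℚ) : ℚ × ℚ :=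
  ((γ 0 0 : ℚ) * v.1 + (γ 1 0 : ℚ) * v.2, (γ 0 1 : ℚ) * v.1 + (γ 1 1 : ℚ) * v.2)

/-- `h` agrees, near `i∞`, with the expansion `∑_{n ≥ n₀} σ_d(c_n) q^{n/N}` where the
coefficients `c_n ∈ ℚ(ζ_N)` are recorded as polynomials in `ζ_N` with rational coefficients
and `σ_d(c_n)` is obtained by evaluating at `ζ_N^d`. -/
def QExp (N : ℕ) (c : ℤ → Polynomial ℚ) (n₀ : ℤ) (d : ℤ) (h : ℍ → ℂ) : Prop :=
  ∃ A : ℝ, ∀ τ : ℍ, A < τ.im →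
    h τ = ∑' n : ℕ, (Polynomial.aeval (e2pi ((d : ℂ) / (N : ℂ))) (c (n₀ + (n : ℤ)))) *
      qpow τ (((n₀ + (n : ℤ) : ℤ) : ℂ) / (N : ℂ))

/-- `h` is meromorphic at `i∞`, with a Fourier expansion in powers of `q^{1/N}`. -/
def CuspExp (N : ℕ) (h : ℍ → ℂ) : Prop :=
  ∃ (n₀ : ℤ) (c : ℤ → ℂ) (A : ℝ), ∀ τ : ℍ, A < τ.im →
    h τ = ∑' n : ℕ, c (n₀ + (n : ℤ)) * qpow τ (((n₀ + (n : ℤ) : ℤ) : ℂ) / (N : ℂ))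

/-- `h` has a Fourier expansion in powers of `q^{1/N}` with rational coefficients. -/
def RatQExp (N : ℕ) (h : ℍ → ℂ) : Prop :=
  ∃ (n₀ : ℤ) (c : ℤ → ℚ) (A : ℝ), ∀ τ : ℍ, A < τ.im →
    h τ = ∑' n : ℕ, (c (n₀ + (n : ℤ)) : ℂ) * qpow τ (((n₀ + (n : ℤ) : ℤ) : ℂ) / (N : ℂ))

/-- `γ ∈ Γ(N)`, i.e. `γ ≡ I₂ (mod N)`. -/
def InGammaN (N : ℕ) (γ : SL2Z) : Prop :=
  ((γ 0 0 : ℤ) : ZMod N) = 1 ∧ ((γ 0 1 : ℤ) : ZMod N) = 0 ∧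
  ((γ 1 0 : ℤ) : ZMod N) = 0 ∧ ((γ 1 1 : ℤ) : ZMod N) = 1

/-- `γ ∈ Γ¹(N)`, i.e. `γ ≡ [[1,0],[*,1]] (mod N)`. -/
def InGamma1Lower (N : ℕ) (γ : SL2Z) : Prop :=
  ((γ 0 0 : ℤ) : ZMod N) = 1 ∧ ((γ 0 1 : ℤ) : ZMod N) = 0 ∧ ((γ 1 1 : ℤ) : ZMod N) = 1

/-- `γ ∈ Γ₁(N)`, i.e. `γ ≡ [[1,*],[0,1]] (mod N)`. -/
def InGamma1Upper (N : ℕ) (γ : SL2Z) : Prop :=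
  ((γ 0 0 : ℤ) : ZMod N) = 1 ∧ ((γ 1 0 : ℤ) : ZMod N) = 0 ∧ ((γ 1 1 : ℤ) : ZMod N) = 1

/-- `h ∈ F_N`: meromorphic on `ℍ`, modular for `Γ(N)`, meromorphic at the cusps and
with Fourier coefficients in `ℚ(ζ_N)`. -/
structure MemFN (N : ℕ) (h : ℍ → ℂ) : Prop where
  merom : IsMeromOnH h
  modular : ∀ γ : SL2Z, InGammaN N γ → ∀ τ : ℍ, h (γ • τ) = h τ
  cusp : ∀ γ : SL2Z, CuspExp N (fun τ => h (γ • τ))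
  coeff : ∃ (c : ℤ → Polynomial ℚ) (n₀ : ℤ), QExp N c n₀ 1 h

/-- `h ∈ F¹_N(ℚ)`: meromorphic on `ℍ`, modular for `Γ¹(N)`, meromorphic at the cusps and
with rational Fourier coefficients. -/
structure MemF1N (N : ℕ) (h : ℍ → ℂ) : Prop where
  merom : IsMeromOnH h
  modular : ∀ γ : SL2Z, InGamma1Lower N γ → ∀ τ : ℍ, h (γ • τ) = h τ
  cusp : ∀ γ : SL2Z, CuspExp N (fun τ => h (γ • τ))
  ratQ : RatQExp N h

/-- `h ∈ O¹_N(ℚ)`: the weakly holomorphic elements of `F¹_N(ℚ)`. -/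
def MemO1N (N : ℕ) (h : ℍ → ℂ) : Prop := MemF1N N h ∧ IsHoloOnH h

/-- `β ∈ SL₂(ℤ)` is a lift of `[[1,0],[0,det γ]]⁻¹ · γ (mod N)`, so that
`γ ≡ [[1,0],[0,det γ]] · β (mod N)`. -/
def SLCompat (N : ℕ) (γ : Matrix (Fin 2) (Fin 2) ℤ) (β : SL2Z) : Prop :=
  ((β 0 0 : ℤ) : ZMod N) = ((γ 0 0 : ℤ) : ZMod N) ∧
  ((β 0 1 : ℤ) : ZMod N) = ((γ 0 1 : ℤ) : ZMod N) ∧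
  ((γ.det : ℤ) : ZMod N) * ((β 1 0 : ℤ) : ZMod N) = ((γ 1 0 : ℤ) : ZMod N) ∧
  ((γ.det : ℤ) : ZMod N) * ((β 1 1 : ℤ) : ZMod N) = ((γ 1 1 : ℤ) : ZMod N)

/-- Condition (F3): for every `γ ∈ GL₂(ℤ/Nℤ)`, written as `[[1,0],[0,d]]·β` with
`d = det γ` and `β ∈ SL₂(ℤ/Nℤ)`, one has `h_v^γ = h_{ᵗγ·v}`; here `h_v^γ = (σ_d h_v) ∘ β`
is expressed through `q`-expansions. -/
def GaloisCompat (N : ℕ) (h : (ℚ × ℚ) → ℍ → ℂ) : Prop :=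
  ∀ v : ℚ × ℚ, InVN N v →
    ∀ γ : Matrix (Fin 2) (Fin 2) ℤ, Int.gcd γ.det (N : ℤ) = 1 →
      ∀ β : SL2Z, SLCompat N γ β →
        ∀ (c : ℤ → Polynomial ℚ) (n₀ : ℤ), QExp N c n₀ 1 (h v) →
          QExp N c n₀ γ.det (fun τ => h (tAct γ v) (β⁻¹ • τ))

/-- A Fricke family of level `N`. -/
structure IsFrickeFamily (N : ℕ) (h : (ℚ × ℚ) → ℍ → ℂ) : Prop where
  mem : ∀ v : ℚ × ℚ, InVN N v → MemFN N (h v)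
  holo : ∀ v : ℚ × ℚ, InVN N v → IsHoloOnH (h v)
  pm : ∀ u v : ℚ × ℚ, InVN N u → InVN N v → PMEquiv u v → h u = h v
  galois : GaloisCompat N h

/-- `ζ₃ = e^{2πi/3}` as a point of `ℍ`. -/
def zeta3H : ℍ := ⟨Complex.exp (2 * Real.pi * Complex.I / 3), by
  have h : (2 * Real.pi * Complex.I / 3 : ℂ) = Complex.I * ((2 * Real.pi / 3 : ℝ) : ℂ) := by
    push_cast; ring
  rw [h]
  rw [show Complex.I * ((2 * Real.pi / 3 : ℝ) : ℂ) = (((2 * Real.pi / 3 : ℝ) : ℂ) * Complex.I) by ring]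
  rw [Complex.exp_ofReal_mul_I_im]
  exact Real.sin_pos_of_pos_of_lt_pi (by positivity) (by nlinarith [Real.pi_pos])⟩

/-- `ζ₄ = i` as a point of `ℍ`. -/
def zeta4H : ℍ := ⟨Complex.I, by simp⟩

/-- The set of points of `ℂ` lying in the `SL₂(ℤ)`-orbit of `ζ₃` or `ζ₄`. -/
def exceptionalSet : Set ℂ :=
  {z : ℂ | ∃ γ : SL2Z, z = ((γ • zeta3H : ℍ) : ℂ) ∨ z = ((γ • zeta4H : ℍ) : ℂ)}

/-- `ℍ' = ℍ ∖ {γζ₃, γζ₄ : γ ∈ SL₂(ℤ)}`, as a subset of `ℂ`. -/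
def upperHalfPlaneSlit : Set ℂ := {z : ℂ | 0 < z.im} \ exceptionalSet

/-- `h` is holomorphic on `ℍ'`. -/
def IsHoloOnH' (h : ℍ → ℂ) : Prop :=
  DifferentiableOn ℂ (asComplexFun h) upperHalfPlaneSlit

/-- Multiplication of a point of `ℍ` by `4`. -/
def fourH (τ : ℍ) : ℍ := ⟨4 * (τ : ℂ), by
  have h : (0:ℝ) < (τ : ℂ).im := τ.2
  have h4 : (4 * (τ : ℂ)).im = 4 * (τ : ℂ).im := by
    simp [Complex.mul_im]
  rw [h4]; linarith⟩


/-- The function `g_{1,4}(τ) = (g_{(1/2,0)}(4τ)/g_{(1/4,0)}(4τ))⁸`. -/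
def g14 (τ : ℍ) : ℂ := (siegel (1 / 2, 0) (fourH τ) / siegel (1 / 4, 0) (fourH τ)) ^ 8

/-- `h ∈ F_{1,4}(ℚ)`: meromorphic on `ℍ`, modular for `Γ₁(4)`, meromorphic at the cusps
and with rational Fourier coefficients (in integral powers of `q`). -/
structure MemF14 (h : ℍ → ℂ) : Prop where
  merom : IsMeromOnH h
  modular : ∀ γ : SL2Z, InGamma1Upper 4 γ → ∀ τ : ℍ, h (γ • τ) = h τ
  cusp : ∀ γ : SL2Z, CuspExp 4 (fun τ => h (γ • τ))
  ratQ : RatQExp 1 h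

/-- `h ∈ O_{1,4}(ℚ)`: the weakly holomorphic elements of `F_{1,4}(ℚ)`. -/
def MemO14 (h : ℍ → ℂ) : Prop := MemF14 h ∧ IsHoloOnH h


noncomputable section
open Complex Matrix UpperHalfPlane MatrixGroups
open Filter Topology

/-- Analytic at `0` with all derivatives at `0` in the subring `R`. -/
def AnIn (R : Subring ℂ) (φ : ℂ → ℂ) : Prop :=
  AnalyticAt ℂ φ 0 ∧ ∀ n : ℕ, iteratedDeriv n φ 0 ∈ R

def ZC : Subring ℂ := (Int.castRingHom ℂ).range
def QC : Subring ℂ := (Rat.castHom ℂ).range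

lemma mem_ZC {x : ℂ} : x ∈ ZC ↔ ∃ n : ℤ, (n : ℂ) = x := by
  simp [ZC]

lemma mem_QC {x : ℂ} : x ∈ QC ↔ ∃ n : ℚ, (n : ℂ) = x := by
  simp [QC]

lemma QC_inv {x : ℂ} (hx : x ∈ QC) : x⁻¹ ∈ QC := by
  rw [mem_QC] at *
  obtain ⟨n, rfl⟩ := hx
  exact ⟨n⁻¹, by push_cast; rfl⟩

lemma ZC_le_QC {x : ℂ} (hx : x ∈ ZC) : x ∈ QC := by
  rw [mem_ZC] at hx
  rw [mem_QC]
  obtain ⟨n, rfl⟩ := hx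
  exact ⟨n, by push_cast; rfl⟩

lemma natCast_mem_R (R : Subring ℂ) (n : ℕ) : (n : ℂ) ∈ R := natCast_mem R n

lemma AnIn.const {R : Subring ℂ} {c : ℂ} (hc : c ∈ R) : AnIn R (fun _ => c) := by
  refine ⟨analyticAt_const, fun n => ?_⟩
  rw [iteratedDeriv_const]
  split_ifs
  · exact hc
  · exact R.zero_mem

lemma AnIn.id {R : Subring ℂ} : AnIn R (fun z => z) := by
  refine ⟨analyticAt_id, fun n => ?_⟩
  rw [iteratedDeriv_fun_id_zero]
  split_ifs
  · exact R.one_mem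
  · exact R.zero_mem

lemma AnIn.mul {R : Subring ℂ} {φ ψ : ℂ → ℂ} (h1 : AnIn R φ) (h2 : AnIn R ψ) :
    AnIn R (fun z => φ z * ψ z) := by
  refine ⟨h1.1.mul h2.1, fun n => ?_⟩
  rw [iteratedDeriv_fun_mul h1.1.contDiffAt h2.1.contDiffAt]
  exact sum_mem fun i _ => R.mul_mem (R.mul_mem (natCast_mem_R R _) (h1.2 _)) (h2.2 _)

lemma AnIn.add {R : Subring ℂ} {φ ψ : ℂ → ℂ} (h1 : AnIn R φ) (h2 : AnIn R ψ) :
    AnIn R (fun z => φ z + ψ z) := by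
  refine ⟨h1.1.add h2.1, fun n => ?_⟩
  have := iteratedDeriv_add (n := n) (h1.1.contDiffAt) (h2.1.contDiffAt)
  have e : (fun z => φ z + ψ z) = φ + ψ := rfl
  rw [e, this]
  exact R.add_mem (h1.2 _) (h2.2 _)

lemma AnIn.neg {R : Subring ℂ} {φ : ℂ → ℂ} (h1 : AnIn R φ) :
    AnIn R (fun z => - φ z) := by
  have := (AnIn.const (R := R) (c := -1) (R.neg_mem R.one_mem)).mul h1
  simpa using this

lemma AnIn.sub {R : Subring ℂ} {φ ψ : ℂ → ℂ} (h1 : AnIn R φ) (h2 : AnIn R ψ) :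
    AnIn R (fun z => φ z - ψ z) := by
  simpa [sub_eq_add_neg] using h1.add h2.neg

lemma AnIn.pow {R : Subring ℂ} {φ : ℂ → ℂ} (h1 : AnIn R φ) (k : ℕ) :
    AnIn R (fun z => φ z ^ k) := by
  induction k with
  | zero => simpa using AnIn.const (R := R) R.one_mem
  | succ k ih => simpa [pow_succ] using ih.mul h1

lemma AnIn.prod {R : Subring ℂ} {ι : Type*} (s : Finset ι) {φ : ι → ℂ → ℂ}
    (h1 : ∀ i, AnIn R (φ i)) : AnIn R (fun z => ∏ i ∈ s, φ i z) := by
  classical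
  induction s using Finset.induction_on with
  | empty => simpa using AnIn.const (R := R) R.one_mem
  | insert a s ha ih => simpa [Finset.prod_insert ha] using (h1 a).mul ih

lemma AnIn.inv {φ : ℂ → ℂ} (h1 : AnIn QC φ) (h0 : φ 0 ≠ 0) :
    AnIn QC (fun z => (φ z)⁻¹) := by
  have han : AnalyticAt ℂ (fun z => (φ z)⁻¹) 0 := h1.1.inv h0
  refine ⟨han, fun n => ?_⟩
  have hev : (fun z => φ z * (φ z)⁻¹) =ᶠ[𝓝 0] fun _ => 1 := by
    filter_upwards [h1.1.continuousAt.eventually_ne h0] with z hz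
    exact mul_inv_cancel₀ hz
  induction n using Nat.strong_induction_on with
  | _ n ih =>
    have h2 := hev.iteratedDeriv_eq n
    rw [iteratedDeriv_fun_mul h1.1.contDiffAt han.contDiffAt, Finset.sum_range_succ'] at h2
    simp only [Nat.choose_zero_right, Nat.cast_one, one_mul, iteratedDeriv_zero,
      Nat.sub_zero] at h2
    have h3 : iteratedDeriv n (fun z => (φ z)⁻¹) 0 = (φ 0)⁻¹ *
      (iteratedDeriv n (fun _ : ℂ => (1:ℂ)) 0 - ∑ k ∈ Finset.range n, (n.choose (k + 1) : ℂ) *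
        iteratedDeriv (k + 1) φ 0 * iteratedDeriv (n - (k + 1)) (fun z => (φ z)⁻¹) 0) := by
      rw [← h2]; field_simp; ring
    rw [h3]
    have hφ0 : φ 0 ∈ QC := by simpa using h1.2 0
    refine QC.mul_mem (QC_inv hφ0) (QC.sub_mem ?_ ?_)
    · exact (AnIn.const QC.one_mem).2 n
    · refine sum_mem fun i hi => QC.mul_mem (QC.mul_mem (natCast_mem_R _ _) (h1.2 _)) (ih _ ?_)
      have := Finset.mem_range.1 hi
      omega

lemma AnIn.congr {R : Subring ℂ} {φ ψ : ℂ → ℂ} (h1 : AnIn R φ) (h : φ =ᶠ[𝓝 0] ψ) :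
    AnIn R ψ :=
  ⟨h1.1.congr h, fun n => by rw [← h.iteratedDeriv_eq n]; exact h1.2 n⟩

lemma AnIn.divX {φ : ℂ → ℂ} (h1 : AnIn QC φ) (h0 : φ 0 = 0) :
    ∃ ψ, AnIn QC ψ ∧ ∀ᶠ z in 𝓝 0, φ z = z * ψ z := by
  refine ⟨dslope φ 0, ?_, ?_⟩
  · have han : AnalyticAt ℂ (dslope φ 0) 0 := by
      obtain ⟨p, hp⟩ := h1.1
      exact ⟨_, hp.has_fpower_series_dslope_fslope⟩
    refine ⟨han, fun n => ?_⟩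
    have e : φ = fun z => z * dslope φ 0 z := by
      funext z
      have := sub_smul_dslope φ 0 z
      simp [h0] at this
      exact this.symm
    have h2 := h1.2 (n + 1)
    rw [e, iteratedDeriv_fun_mul (f := fun z => z) analyticAt_id.contDiffAt han.contDiffAt,
      Finset.sum_eq_single 1] at h2
    · simp only [iteratedDeriv_fun_id_zero] at h2
      simp at h2
      have h3 := QC.mul_mem (QC_inv (natCast_mem_R QC (n+1))) h2
      push_cast at h3
      rwa [inv_mul_cancel_left₀] at h3
      exact_mod_cast Nat.succ_ne_zero n
    · intro b _ hb
      rw [iteratedDeriv_fun_id_zero, if_neg hb]; simp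
    · intro h; simp at h
  · refine Eventually.of_forall fun z => ?_
    have := sub_smul_dslope φ 0 z
    simp [h0] at this
    exact this.symm

/-- Euler product. -/
def PE (q : ℂ) : ℂ := ∏' n : ℕ, (1 - q ^ (n + 1))

lemma PE_zero : PE 0 = 1 := by simp [PE]

lemma AnIn_PE_pow (m : ℕ) (hm : m ≠ 0) : AnIn ZC (fun z => PE (z ^ m)) := by
  have hmap : Set.MapsTo (fun z : ℂ => z ^ m) (Metric.ball 0 1) (Metric.ball 0 1) := by
    intro z hz
    simp only [mem_ball_zero_iff, norm_pow] at *
    exact pow_lt_one₀ (norm_nonneg _) hz hm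
  have h1 := ModularForm.multipliableLocallyUniformlyOn_one_sub_pow.hasProdLocallyUniformlyOn
  have h2 : TendstoLocallyUniformlyOn
      (fun (s : Finset ℕ) (z : ℂ) => ∏ n ∈ s, (1 - (z ^ m) ^ (n + 1)))
      (fun z => PE (z ^ m)) atTop (Metric.ball 0 1) := by
    have := TendstoLocallyUniformlyOn.comp h1 (fun z : ℂ => z ^ m) hmap (by fun_prop)
    exact this
  have hd : ∀ s : Finset ℕ, DifferentiableOn ℂ (fun z : ℂ => ∏ n ∈ s, (1 - (z ^ m) ^ (n + 1)))
      (Metric.ball 0 1) := fun s => by fun_prop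
  have hiter : ∀ k : ℕ, TendstoLocallyUniformlyOn
      (fun (s : Finset ℕ) => iteratedDeriv k (fun z : ℂ => ∏ n ∈ s, (1 - (z ^ m) ^ (n + 1))))
      (iteratedDeriv k (fun z => PE (z ^ m))) atTop (Metric.ball 0 1) ∧
      ∀ s : Finset ℕ, DifferentiableOn ℂ
        (iteratedDeriv k (fun z : ℂ => ∏ n ∈ s, (1 - (z ^ m) ^ (n + 1)))) (Metric.ball 0 1) := by
    intro k
    induction k with
    | zero => simpa using ⟨h2, hd⟩
    | succ k ih =>
      refine ⟨?_, fun s => ?_⟩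
      · have := ih.1.deriv (Eventually.of_forall ih.2) Metric.isOpen_ball
        simpa [iteratedDeriv_succ, Function.comp_def] using this
      · rw [iteratedDeriv_succ]
        exact (ih.2 s).deriv Metric.isOpen_ball
  refine ⟨?_, fun k => ?_⟩
  · exact (h2.differentiableOn (Eventually.of_forall hd) Metric.isOpen_ball).analyticAt
      (Metric.ball_mem_nhds _ one_pos)
  · have ht := (hiter k).1.tendsto_at (Metric.mem_ball_self (x := (0:ℂ)) one_pos)
    have hcl : IsClosed (Set.range ((↑) : ℤ → ℂ)) := Complex.isClosedEmbedding_intCast.isClosed_range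
    rw [mem_ZC]
    refine hcl.mem_of_tendsto ht (Eventually.of_forall fun s => ?_)
    rw [← mem_ZC.trans Set.mem_range.symm]
    refine (AnIn.prod s fun n => ?_ : AnIn ZC _).2 k
    exact (AnIn.const ZC.one_mem).sub ((AnIn.id.pow m).pow (n + 1))

lemma AnIn_PE_pow_Q (m : ℕ) (hm : m ≠ 0) : AnIn QC (fun z => PE (z ^ m)) :=
  ⟨(AnIn_PE_pow m hm).1, fun n => ZC_le_QC ((AnIn_PE_pow m hm).2 n)⟩

lemma AnIn.hasSum {φ : ℂ → ℂ} (h : AnIn QC φ) :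
    ∃ c : ℕ → ℚ, ∀ᶠ z in 𝓝 (0 : ℂ), HasSum (fun n => (c n : ℂ) * z ^ n) (φ z) := by
  have hh := fun n => mem_QC.1 (h.2 n)
  choose c hc using hh
  refine ⟨fun n => c n / n.factorial, ?_⟩
  have := h.1.hasFPowerSeriesAt.eventually_hasSum
  filter_upwards [this] with z hz
  simpa [FormalMultilinearSeries.ofScalars, hc, mul_comm, ← mul_assoc] using hz

lemma AnIn_of_hasSum {c : ℕ → ℚ} {r : ℝ} (hr : 0 < r)
    (hs : Summable fun n => ‖(c n : ℂ)‖ * r ^ n) :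
    AnIn QC (fun z => ∑' n, (c n : ℂ) * z ^ n) := by
  set p := FormalMultilinearSeries.ofScalars ℂ (fun n => (c n : ℂ)) with hp
  have hrad : ENNReal.ofReal r ≤ p.radius := by
    have := p.le_radius_of_summable_norm (r := ⟨r, hr.le⟩) (by
      refine hs.congr fun n => ?_
      simp [hp]
      exact Or.inl rfl)
    rwa [ENNReal.ofReal_eq_coe_nnreal hr.le]
  have hpos : 0 < p.radius := lt_of_lt_of_le (by simpa using hr) hrad
  have hf := p.hasFPowerSeriesOnBall hpos
  have e : (fun z => ∑' n, (c n : ℂ) * z ^ n) = p.sum := by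
    funext z
    simp [FormalMultilinearSeries.sum, hp, FormalMultilinearSeries.ofScalars, mul_comm]
  rw [e]
  refine ⟨hf.hasFPowerSeriesAt.analyticAt, fun n => ?_⟩
  have h1 := hf.hasFPowerSeriesAt.analyticAt.hasFPowerSeriesAt
  have h2 := h1.eq_formalMultilinearSeries hf.hasFPowerSeriesAt
  have h3 := congrArg (fun q => q.coeff n) h2
  simp only [hp, FormalMultilinearSeries.coeff_ofScalars] at h3
  rw [div_eq_iff (by exact_mod_cast n.factorial_ne_zero)] at h3
  rw [← hp] at h3
  rw [h3]
  exact QC.mul_mem (mem_QC.2 ⟨_, rfl⟩) (natCast_mem_R _ _)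

end

noncomputable section
open Complex Matrix UpperHalfPlane MatrixGroups
open Filter Topology

/-- Eighth power of the Dedekind eta function. -/
def E8 (z : ℂ) : ℂ := ModularForm.eta z ^ 8

def omg : ℂ := Complex.exp (2 * Real.pi * Complex.I / 3)

lemma omg_ne : omg ≠ 0 := Complex.exp_ne_zero _

lemma omg_cube : omg ^ 3 = 1 := by
  rw [omg, ← Complex.exp_nat_mul]
  rw [show ((3:ℕ):ℂ) * (2 * Real.pi * Complex.I / 3) = 2 * Real.pi * Complex.I by push_cast; ring]
  exact Complex.exp_two_pi_mul_I

lemma norm_omg : ‖omg‖ = 1 := by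
  have h : ‖omg‖ ^ 3 = 1 := by rw [← norm_pow, omg_cube, norm_one]
  exact (pow_eq_one_iff_of_nonneg (norm_nonneg _) (by norm_num)).1 h

lemma E8_eq (z : ℂ) : E8 z = Complex.exp (2 * Real.pi * Complex.I * z / 3) * PE (e2pi z) ^ 8 := by
  have h1 : ∀ n : ℕ, ModularForm.eta_q n z = e2pi z ^ (n + 1) := fun n => by
    rw [ModularForm.eta_q_eq_pow, e2pi]
  rw [E8, ModularForm.eta, mul_pow, Function.Periodic.qParam, ← Complex.exp_nat_mul, PE]
  simp_rw [h1]
  congr 2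
  push_cast; ring

lemma E8_ne {z : ℂ} (hz : 0 < z.im) : E8 z ≠ 0 := pow_ne_zero _ (ModularForm.eta_ne_zero hz)

lemma E8_diff {z : ℂ} (hz : 0 < z.im) : DifferentiableAt ℂ E8 z :=
  (ModularForm.differentiableAt_eta_of_mem_upperHalfPlaneSet hz).pow 8

lemma e2pi_add_one (z : ℂ) : e2pi (z + 1) = e2pi z := by
  rw [e2pi, e2pi, mul_add, Complex.exp_add, mul_one, Complex.exp_two_pi_mul_I, mul_one]

lemma E8_add_one (z : ℂ) : E8 (z + 1) = omg * E8 z := by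
  rw [E8_eq, E8_eq, e2pi_add_one, omg, ← mul_assoc, ← Complex.exp_add]
  congr 3; ring

lemma csqrt_pow8 {z : ℂ} (hz : z ≠ 0) : Complex.sqrt z ^ 8 = z ^ 4 := by
  rw [_root_.sqrt_eq_exp hz, ← Complex.exp_nat_mul]
  rw [show ((8:ℕ):ℂ) * (Complex.log z / 2) = ((4:ℕ):ℂ) * Complex.log z by push_cast; ring]
  rw [Complex.exp_nat_mul, Complex.exp_log hz]

lemma E8_inv {z : ℂ} (hz : 0 < z.im) : E8 (-1 / z) = z ^ 4 * E8 z := by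
  have h := ModularForm.eta_comp_eq_csqrt_I_inv (show z ∈ upperHalfPlaneSet from hz)
  simp only [Function.comp_apply, Pi.smul_apply, Pi.mul_apply, smul_eq_mul] at h
  have hz0 : z ≠ 0 := by rintro rfl; simp at hz
  rw [E8, h, mul_pow, mul_pow, inv_pow, csqrt_pow8 hz0, csqrt_pow8 Complex.I_ne_zero, E8,
    Complex.I_pow_four]
  simp

lemma E8_sub_one (z : ℂ) : omg * E8 (z - 1) = E8 z := by
  rw [← E8_add_one]; congr 1; ring

lemma im_neg_inv {z : ℂ} (hz : 0 < z.im) : 0 < (-1 / z).im := by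
  rw [neg_div, one_div, Complex.neg_im, Complex.inv_im, neg_div, neg_neg]
  have : z ≠ 0 := by rintro rfl; simp at hz
  exact div_pos hz (Complex.normSq_pos.2 this)

/-- `E8 (z/(z+1))` -/
lemma E8_U1 {z : ℂ} (hz : 0 < z.im) : omg * E8 (z / (z + 1)) = (z + 1) ^ 4 * E8 z := by
  have hz0 : z ≠ 0 := by rintro rfl; simp at hz
  have hz1 : 0 < (z + 1).im := by simpa using hz
  have hz2 : z + 1 ≠ 0 := by intro h; rw [h] at hz1; simp at hz1
  have hw : 0 < (-1 / (z + 1)).im := im_neg_inv hz1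
  have h2 : z / (z + 1) = -1 / (z + 1) + 1 := by field_simp; ring
  rw [h2, E8_add_one, E8_inv hz1, E8_add_one]
  linear_combination (z+1)^4 * E8 z * omg_cube

lemma im_div_add_one {z : ℂ} (hz : 0 < z.im) : 0 < (z / (z + 1)).im := by
  have hz1 : 0 < (z + 1).im := by simpa using hz
  have hz2 : z + 1 ≠ 0 := by intro h; rw [h] at hz1; simp at hz1
  have h2 : z / (z + 1) = -1 / (z + 1) + 1 := by field_simp; ring
  rw [h2]; simpa using im_neg_inv hz1

lemma E8_U2 {z : ℂ} (hz : 0 < z.im) :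
    omg ^ 2 * E8 (z / (2 * z + 1)) = (2 * z + 1) ^ 4 * E8 z := by
  have hz1 : 0 < (z + 1).im := by simpa using hz
  have hz2 : z + 1 ≠ 0 := by intro h; rw [h] at hz1; simp at hz1
  have hz3 : 2 * z + 1 ≠ 0 := by
    intro h; have := congrArg Complex.im h; simp at this; exact hz.ne' this
  have h1 := E8_U1 hz
  have h2 := E8_U1 (im_div_add_one hz)
  have e1 : z / (z + 1) + 1 = (2 * z + 1) / (z + 1) := by field_simp; ring
  have e2 : z / (z + 1) / (z / (z + 1) + 1) = z / (2 * z + 1) := by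
    rw [e1]; field_simp
  rw [e2, e1] at h2
  have : omg ^ 2 * E8 (z / (2 * z + 1)) = ((2 * z + 1) / (z + 1)) ^ 4 *
      (omg * E8 (z / (z + 1))) := by linear_combination omg * h2
  rw [this, h1]; field_simp

lemma im_two {z : ℂ} (hz : 0 < z.im) : 0 < (2 * z).im := by simpa using hz
lemma im_four {z : ℂ} (hz : 0 < z.im) : 0 < (4 * z).im := by simpa using hz
lemma im_half {z : ℂ} (hz : 0 < z.im) : 0 < (z + 1 / 2).im := by simpa using hz

lemma E8_U4 {z : ℂ} (hz : 0 < z.im) :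
    E8 (4 * z / (2 * z + 1)) = omg ^ 2 * (z + 1 / 2) ^ 4 * E8 (z + 1 / 2) := by
  have hz3 : 2 * z + 1 ≠ 0 := by
    intro h; have := congrArg Complex.im h; simp at this; exact hz.ne' this
  have hh := im_half hz
  have hz4 : z + 1 / 2 ≠ 0 := by intro h; rw [h] at hh; simp at hh
  have e : 4 * z / (2 * z + 1) = -1 / (z + 1 / 2) + 1 + 1 := by
    have h : -1 / (z + 1 / 2) * (z + 1 / 2) = -1 := div_mul_cancel₀ _ hz4
    rw [div_eq_iff hz3]; linear_combination -2 * h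
  rw [e, E8_add_one, E8_add_one, E8_inv hh]; ring

/-- The eta quotient equal to `g14`. -/
def Gf (z : ℂ) : ℂ := E8 (2 * z) ^ 3 / (E8 z * E8 (4 * z) ^ 2)
/-- The eta quotient equal to `g14 - 16`. -/
def Kf (z : ℂ) : ℂ := E8 z / E8 (4 * z)
/-- The Fricke transform of `Gf`, up to a constant. -/
def Lf (z : ℂ) : ℂ := E8 (2 * z) ^ 3 / (E8 z ^ 2 * E8 (4 * z))

lemma Gf_ne {z : ℂ} (hz : 0 < z.im) : Gf z ≠ 0 :=
  div_ne_zero (pow_ne_zero _ (E8_ne (im_two hz)))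
    (mul_ne_zero (E8_ne hz) (pow_ne_zero _ (E8_ne (im_four hz))))
lemma Kf_ne {z : ℂ} (hz : 0 < z.im) : Kf z ≠ 0 :=
  div_ne_zero (E8_ne hz) (E8_ne (im_four hz))

lemma Gf_diff {z : ℂ} (hz : 0 < z.im) : DifferentiableAt ℂ Gf z := by
  have h1 := E8_diff hz
  have h2 : DifferentiableAt ℂ (fun z => E8 (2 * z)) z :=
    DifferentiableAt.comp z (E8_diff (im_two hz)) (by fun_prop)
  have h4 : DifferentiableAt ℂ (fun z => E8 (4 * z)) z :=
    DifferentiableAt.comp z (E8_diff (im_four hz)) (by fun_prop)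
  exact (h2.pow 3).div (h1.mul (h4.pow 2))
    (mul_ne_zero (E8_ne hz) (pow_ne_zero _ (E8_ne (im_four hz))))

lemma Kf_diff {z : ℂ} (hz : 0 < z.im) : DifferentiableAt ℂ Kf z := by
  have h4 : DifferentiableAt ℂ (fun z => E8 (4 * z)) z :=
    DifferentiableAt.comp z (E8_diff (im_four hz)) (by fun_prop)
  exact (E8_diff hz).div h4 (E8_ne (im_four hz))

lemma E8_two_add (z : ℂ) : E8 (2 * (z + 1)) = omg ^ 2 * E8 (2 * z) := by
  rw [show 2 * (z + 1) = 2 * z + 1 + 1 by ring, E8_add_one, E8_add_one]; ring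
lemma E8_four_add (z : ℂ) : E8 (4 * (z + 1)) = omg * E8 (4 * z) := by
  rw [show 4 * (z + 1) = 4 * z + 1 + 1 + 1 + 1 by ring, E8_add_one, E8_add_one, E8_add_one,
    E8_add_one]
  linear_combination omg * E8 (4 * z) * omg_cube

lemma Gf_add_one {z : ℂ} (hz : 0 < z.im) : Gf (z + 1) = Gf z := by
  rw [Gf, Gf, E8_two_add, E8_four_add, E8_add_one]
  have h1 := E8_ne hz
  have h4 := E8_ne (im_four hz)
  have ho := omg_ne
  generalize E8 (4 * z) = w4 at *
  generalize E8 (2 * z) = w2 at *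
  generalize E8 z = w1 at *
  field_simp
  linear_combination w2 ^ 3 * omg_cube
lemma Kf_add_one (z : ℂ) : Kf (z + 1) = Kf z := by
  rw [Kf, Kf, E8_four_add, E8_add_one, mul_div_mul_left _ _ omg_ne]
lemma Lf_add_one {z : ℂ} (hz : 0 < z.im) : Lf (z + 1) = Lf z := by
  rw [Lf, Lf, E8_two_add, E8_four_add, E8_add_one]
  have h1 := E8_ne hz
  have h4 := E8_ne (im_four hz)
  have ho := omg_ne
  generalize E8 (4 * z) = w4 at *
  generalize E8 (2 * z) = w2 at *
  generalize E8 z = w1 at *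
  field_simp
  linear_combination w2 ^ 3 * omg_cube

lemma fricke_aux {z : ℂ} (hz : 0 < z.im) :
    E8 (-1 / (4 * z)) = (4 * z) ^ 4 * E8 (4 * z) ∧
    E8 (2 * (-1 / (4 * z))) = (2 * z) ^ 4 * E8 (2 * z) ∧
    E8 (4 * (-1 / (4 * z))) = z ^ 4 * E8 z := by
  have hz0 : z ≠ 0 := by rintro rfl; simp at hz
  refine ⟨E8_inv (im_four hz), ?_, ?_⟩
  · rw [← E8_inv (im_two hz)]; congr 1; field_simp; norm_num
  · rw [← E8_inv hz]; congr 1; field_simp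

lemma Gf_fricke {z : ℂ} (hz : 0 < z.im) : Gf (-1 / (4 * z)) = 16 * Lf z := by
  have hz0 : z ≠ 0 := by rintro rfl; simp at hz
  obtain ⟨e1, e2, e4⟩ := fricke_aux hz
  have h1 := E8_ne hz
  have h4 := E8_ne (im_four hz)
  rw [Gf, Lf, e1, e2, e4]
  generalize E8 (4 * z) = w4 at *
  generalize E8 (2 * z) = w2 at *
  generalize E8 z = w1 at *
  field_simp; ring

lemma Kf_fricke {z : ℂ} (hz : 0 < z.im) : Kf (-1 / (4 * z)) = 256 / Kf z := by
  have hz0 : z ≠ 0 := by rintro rfl; simp at hz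
  obtain ⟨e1, e2, e4⟩ := fricke_aux hz
  have h1 := E8_ne hz
  have h4 := E8_ne (im_four hz)
  rw [Kf, Kf, e1, e4]; field_simp; norm_num

lemma Gf_V {z : ℂ} (hz : 0 < z.im) : Gf (z / (2 * z + 1)) =
    256 * omg * (E8 (2 * z) ^ 3 / (E8 z * E8 (z + 1 / 2) ^ 2)) := by
  have hz3 : 2 * z + 1 ≠ 0 := by
    intro h; have := congrArg Complex.im h; simp at this; exact hz.ne' this
  have a1 := E8_U2 hz
  have a2 := E8_U1 (im_two hz)
  have a4 := E8_U4 hz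
  have h1 := E8_ne hz
  have h5 := E8_ne (im_half hz)
  have ho := omg_ne
  have b1 : E8 (z / (2 * z + 1)) = omg * ((2 * z + 1) ^ 4 * E8 z) := by
    linear_combination omg * a1 - E8 (z / (2 * z + 1)) * omg_cube
  have b2 : E8 (2 * z / (2 * z + 1)) = omg ^ 2 * ((2 * z + 1) ^ 4 * E8 (2 * z)) := by
    linear_combination omg ^ 2 * a2 - E8 (2 * z / (2 * z + 1)) * omg_cube
  have e : z + 1 / 2 = (2 * z + 1) / 2 := by ring
  have b4 : E8 (4 * z / (2 * z + 1)) = omg ^ 2 * ((2 * z + 1) ^ 4 / 16 * E8 (z + 1 / 2)) := by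
    rw [a4]; ring
  rw [Gf, ← mul_div_assoc, ← mul_div_assoc, b1, b2, b4]
  field_simp
  norm_num

lemma Kf_V {z : ℂ} (hz : 0 < z.im) : Kf (z / (2 * z + 1)) =
    16 * omg ^ 2 * (E8 z / E8 (z + 1 / 2)) := by
  have hz3 : 2 * z + 1 ≠ 0 := by
    intro h; have := congrArg Complex.im h; simp at this; exact hz.ne' this
  have a1 := E8_U2 hz
  have a4 := E8_U4 hz
  have h1 := E8_ne hz
  have h5 := E8_ne (im_half hz)
  have ho := omg_ne
  have b1 : E8 (z / (2 * z + 1)) = omg * ((2 * z + 1) ^ 4 * E8 z) := by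
    linear_combination omg * a1 - E8 (z / (2 * z + 1)) * omg_cube
  have b4 : E8 (4 * z / (2 * z + 1)) = omg ^ 2 * ((2 * z + 1) ^ 4 / 16 * E8 (z + 1 / 2)) := by
    rw [a4]; ring
  rw [Kf, ← mul_div_assoc, b1, b4]
  generalize E8 (z + 1 / 2) = w5 at *
  generalize E8 z = w1 at *
  field_simp
  linear_combination -omg_cube
end

noncomputable section
open Complex Matrix UpperHalfPlane MatrixGroups
open Filter Topology

lemma mult_arith {x : ℂ} (hx : ‖x‖ < 1) (k l : ℕ) (hk : k ≠ 0) :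
    Multipliable fun n : ℕ => 1 - x ^ (k * n + l) := by
  simp_rw [sub_eq_add_neg]
  apply multipliable_one_add_of_summable
  simp_rw [norm_neg, norm_pow, pow_add, pow_mul]
  exact (summable_geometric_of_lt_one (by positivity)
    (pow_lt_one₀ (norm_nonneg _) hx hk)).mul_right _

lemma tprod_first {x : ℂ} (hx : ‖x‖ < 1) (k : ℕ) (hk : k ≠ 0) :
    (1 - x) * ∏' n : ℕ, (1 - x ^ (k * n + (k + 1))) = ∏' n : ℕ, (1 - x ^ (k * n + 1)) := by
  have e : ∀ n : ℕ, k * (n + 1) + 1 = k * n + (k + 1) := fun n => by ring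
  have m : Multipliable fun n : ℕ => 1 - x ^ (k * (n + 1) + 1) := by
    simp_rw [e]; exact mult_arith hx k (k + 1) hk
  rw [tprod_eq_zero_mul' (f := fun n : ℕ => 1 - x ^ (k * n + 1)) m]
  simp_rw [e]
  simp

/-- `∏ (1 - x^(2n+1))`. -/
def OD (x : ℂ) : ℂ := ∏' n : ℕ, (1 - x ^ (2 * n + 1))

lemma OD_mul_PE {x : ℂ} (hx : ‖x‖ < 1) : OD x * PE (x ^ 2) = PE x := by
  have h := tprod_even_mul_odd (f := fun n : ℕ => 1 - x ^ (n + 1))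
    (by simpa using mult_arith hx 2 1 (by norm_num))
    (by simpa [add_assoc] using mult_arith hx 2 2 (by norm_num))
  rw [PE, PE, OD, ← h]
  congr 1
  apply tprod_congr; intro n; rw [← pow_mul]; ring_nf

lemma OD_split {x : ℂ} (hx : ‖x‖ < 1) :
    (1 - x) * ∏' n : ℕ, ((1 - x ^ (4 * n + 5)) * (1 - x ^ (4 * n + 3))) = OD x := by
  have m1 := mult_arith hx 4 1 (by norm_num)
  have m5 := mult_arith hx 4 5 (by norm_num)
  have m3 := mult_arith hx 4 3 (by norm_num)
  rw [m5.tprod_mul m3, ← mul_assoc]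
  have h := tprod_even_mul_odd (f := fun n : ℕ => 1 - x ^ (2 * n + 1))
    (by convert m1 using 4; ring) (by convert m3 using 4; ring)
  rw [OD, ← h]
  congr 1
  · rw [tprod_first hx 4 (by norm_num)]
    apply tprod_congr; intro n; ring_nf
  · apply tprod_congr; intro n; ring_nf

lemma OD_split2 {x : ℂ} (hx : ‖x‖ < 1) :
    (1 - x) * ∏' n : ℕ, ((1 - x ^ (2 * n + 3)) * (1 - x ^ (2 * n + 1))) = OD x ^ 2 := by
  have m1 := mult_arith hx 2 1 (by norm_num)
  have m3 := mult_arith hx 2 3 (by norm_num)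
  rw [m3.tprod_mul m1, ← mul_assoc, sq]
  congr 1
  exact tprod_first hx 2 (by norm_num)

lemma norm_e2pi_lt {z : ℂ} (hz : 0 < z.im) : ‖e2pi z‖ < 1 := by
  have := UpperHalfPlane.norm_exp_two_pi_I_lt_one ⟨z, hz⟩
  simpa [e2pi] using this

lemma e2pi_nat_mul (n : ℕ) (z : ℂ) : e2pi (n * z) = e2pi z ^ n := by
  rw [e2pi, e2pi, ← Complex.exp_nat_mul]; ring_nf

lemma PE_ne {z : ℂ} (hz : 0 < z.im) : PE (e2pi z) ≠ 0 := by
  have := E8_ne hz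
  rw [E8_eq] at this
  intro h; rw [h] at this; simp at this

lemma e2pi_ne (z : ℂ) : e2pi z ≠ 0 := Complex.exp_ne_zero _

/-- q-expansion of `Gf`, without the pole. -/
def Aq (q : ℂ) : ℂ := (PE (q ^ 2) ^ 3 * (PE q * PE (q ^ 4) ^ 2)⁻¹) ^ 8
/-- q-expansion of `Kf`, without the pole. -/
def Bq (q : ℂ) : ℂ := (PE q * (PE (q ^ 4))⁻¹) ^ 8

lemma e2pi_two (z : ℂ) : e2pi (2 * z) = e2pi z ^ 2 := by simpa using e2pi_nat_mul 2 z
lemma e2pi_four (z : ℂ) : e2pi (4 * z) = e2pi z ^ 4 := by simpa using e2pi_nat_mul 4 z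

lemma Gf_eq {z : ℂ} (hz : 0 < z.im) : Gf z = (e2pi z)⁻¹ * Aq (e2pi z) := by
  have p1 := PE_ne hz
  have p4 := PE_ne (im_four hz)
  have hq := e2pi_ne z
  rw [e2pi_four] at p4
  rw [Gf, Aq, E8_eq, E8_eq, E8_eq, e2pi_two, e2pi_four]
  have e2 : Complex.exp (2 * Real.pi * Complex.I * (2 * z) / 3)
      = Complex.exp (2 * Real.pi * Complex.I * z / 3) ^ 2 := by
    rw [← Complex.exp_nat_mul]; congr 1; push_cast; ring
  have e4 : Complex.exp (2 * Real.pi * Complex.I * (4 * z) / 3)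
      = Complex.exp (2 * Real.pi * Complex.I * z / 3) ^ 4 := by
    rw [← Complex.exp_nat_mul]; congr 1; push_cast; ring
  have e3 : e2pi z = Complex.exp (2 * Real.pi * Complex.I * z / 3) ^ 3 := by
    rw [e2pi, ← Complex.exp_nat_mul]; congr 1; push_cast; ring
  rw [e2, e4]
  have hr : Complex.exp (2 * Real.pi * Complex.I * z / 3) ≠ 0 := Complex.exp_ne_zero _
  generalize PE (e2pi z ^ 2) = w2 at *
  generalize PE (e2pi z ^ 4) = w4 at *
  generalize PE (e2pi z) = w1 at *
  rw [e3]
  generalize Complex.exp (2 * Real.pi * Complex.I * z / 3) = r at *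
  field_simp

lemma Kf_eq {z : ℂ} (hz : 0 < z.im) : Kf z = (e2pi z)⁻¹ * Bq (e2pi z) := by
  have p1 := PE_ne hz
  have p4 := PE_ne (im_four hz)
  have hq := e2pi_ne z
  rw [e2pi_four] at p4
  rw [Kf, Bq, E8_eq, E8_eq, e2pi_four]
  have e4 : Complex.exp (2 * Real.pi * Complex.I * (4 * z) / 3)
      = Complex.exp (2 * Real.pi * Complex.I * z / 3) ^ 4 := by
    rw [← Complex.exp_nat_mul]; congr 1; push_cast; ring
  have e3 : e2pi z = Complex.exp (2 * Real.pi * Complex.I * z / 3) ^ 3 := by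
    rw [e2pi, ← Complex.exp_nat_mul]; congr 1; push_cast; ring
  rw [e4]
  have hr : Complex.exp (2 * Real.pi * Complex.I * z / 3) ≠ 0 := Complex.exp_ne_zero _
  generalize PE (e2pi z ^ 4) = w4 at *
  generalize PE (e2pi z) = w1 at *
  rw [e3]
  generalize Complex.exp (2 * Real.pi * Complex.I * z / 3) = r at *
  field_simp

lemma qpow_fourH (τ : ℍ) (x : ℂ) : qpow (fourH τ) x = e2pi (4 * x * τ) := by
  rw [qpow, e2pi]; congr 1
  show 2 * Real.pi * Complex.I * x * (4 * (τ:ℂ)) = _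
  ring

lemma siegel_quarter (τ : ℍ) :
    siegel (1 / 4, 0) (fourH τ) = -e2pi (-τ / 24) * OD (e2pi τ) := by
  rw [siegel, ← OD_split (norm_e2pi_lt τ.2)]
  simp only [qpow_fourH]
  have h0 : e2pi (((0:ℚ):ℂ)) = 1 := by simp [e2pi]
  have h0' : e2pi (-((0:ℚ):ℂ)) = 1 := by simp [e2pi]
  rw [h0, h0']
  have e1 : e2pi (4 * (((1 / 4 : ℚ)) : ℂ) * τ) = e2pi τ := by congr 1; push_cast; ring
  rw [e1]
  simp only [mul_one]
  have e5 : ∀ n : ℕ, e2pi (4 * ((n:ℂ) + 1 + ((1 / 4 : ℚ) : ℂ)) * τ) = e2pi τ ^ (4 * n + 5) := by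
    intro n; rw [← e2pi_nat_mul]; congr 1; push_cast; ring
  have e3 : ∀ n : ℕ, e2pi (4 * ((n:ℂ) + 1 - ((1 / 4 : ℚ) : ℂ)) * τ) = e2pi τ ^ (4 * n + 3) := by
    intro n; rw [← e2pi_nat_mul]; congr 1; push_cast; ring
  simp_rw [e5, e3]
  rw [← mul_assoc]
  congr 2
  rw [Rat.cast_zero, mul_zero, zero_mul, Complex.exp_zero, neg_mul, one_mul]
  congr 2; push_cast; ring

lemma siegel_half (τ : ℍ) :
    siegel (1 / 2, 0) (fourH τ) = -e2pi (-τ / 6) * OD (e2pi τ ^ 2) ^ 2 := by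
  have hn : ‖e2pi τ ^ 2‖ < 1 := by
    rw [norm_pow]; exact pow_lt_one₀ (norm_nonneg _) (norm_e2pi_lt τ.2) (by norm_num)
  rw [siegel, ← OD_split2 hn]
  simp only [qpow_fourH]
  have h0 : e2pi (((0:ℚ):ℂ)) = 1 := by simp [e2pi]
  have h0' : e2pi (-((0:ℚ):ℂ)) = 1 := by simp [e2pi]
  rw [h0, h0']
  have e1 : e2pi (4 * (((1 / 2 : ℚ)) : ℂ) * τ) = e2pi τ ^ 2 := by
    rw [← e2pi_two]; congr 1; push_cast; ring
  rw [e1]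
  simp only [mul_one]
  have e5 : ∀ n : ℕ, e2pi (4 * ((n:ℂ) + 1 + ((1 / 2 : ℚ) : ℂ)) * τ)
      = (e2pi τ ^ 2) ^ (2 * n + 3) := by
    intro n; rw [← pow_mul, ← e2pi_nat_mul]; congr 1; push_cast; ring
  have e3 : ∀ n : ℕ, e2pi (4 * ((n:ℂ) + 1 - ((1 / 2 : ℚ) : ℂ)) * τ)
      = (e2pi τ ^ 2) ^ (2 * n + 1) := by
    intro n; rw [← pow_mul, ← e2pi_nat_mul]; congr 1; push_cast; ring
  simp_rw [e5, e3]
  rw [← mul_assoc]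
  congr 2
  rw [Rat.cast_zero, mul_zero, zero_mul, Complex.exp_zero, neg_mul, one_mul]
  congr 2; push_cast; ring

lemma g14_eq (τ : ℍ) : g14 τ = Gf τ := by
  have hz : 0 < (τ:ℂ).im := τ.2
  rw [g14, siegel_half, siegel_quarter, Gf_eq hz]
  have hn : ‖e2pi τ ^ 2‖ < 1 := by
    rw [norm_pow]; exact pow_lt_one₀ (norm_nonneg _) (norm_e2pi_lt τ.2) (by norm_num)
  have o1 := OD_mul_PE (norm_e2pi_lt hz)
  have o2 := OD_mul_PE hn
  rw [← pow_mul] at o2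
  norm_num at o2
  have p1 := PE_ne hz
  have p2 := PE_ne (im_two hz)
  have p4 := PE_ne (im_four hz)
  rw [e2pi_four] at p4
  rw [e2pi_two] at p2
  have x1 : OD (e2pi τ) = PE (e2pi τ) / PE (e2pi τ ^ 2) := by rw [← o1]; field_simp
  have x2 : OD (e2pi τ ^ 2) = PE (e2pi τ ^ 2) / PE (e2pi τ ^ 4) := by rw [← o2]; field_simp
  rw [x1, x2, Aq]
  have r4 : e2pi (-τ / 6) = e2pi (-τ / 24) ^ 4 := by
    rw [← e2pi_nat_mul]; congr 1; push_cast; ring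
  have r24 : (e2pi τ)⁻¹ = e2pi (-τ / 24) ^ 24 := by
    rw [← e2pi_nat_mul, e2pi, e2pi, ← Complex.exp_neg]; congr 1; push_cast; ring
  rw [r4, r24]
  have hr := e2pi_ne (-τ / 24)
  generalize PE (e2pi τ ^ 2) = w2 at *
  generalize PE (e2pi τ ^ 4) = w4 at *
  generalize PE (e2pi τ) = w1 at *
  generalize e2pi (-τ / 24) = r at *
  field_simp

lemma AnIn_Aq : AnIn QC Aq ∧ Aq 0 = 1 := by
  have h1 := AnIn_PE_pow_Q 1 (by norm_num)
  have h2 := AnIn_PE_pow_Q 2 (by norm_num)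
  have h4 := AnIn_PE_pow_Q 4 (by norm_num)
  simp only [pow_one] at h1
  constructor
  · have := (h1.mul (h4.pow 2)).inv (by simp [PE_zero])
    exact ((h2.pow 3).mul this).pow 8
  · simp [Aq, PE_zero]

lemma AnIn_Bq : AnIn QC Bq ∧ Bq 0 = 1 := by
  have h1 := AnIn_PE_pow_Q 1 (by norm_num)
  have h4 := AnIn_PE_pow_Q 4 (by norm_num)
  simp only [pow_one] at h1
  constructor
  · exact (h1.mul (h4.inv (by simp [PE_zero]))).pow 8
  · simp [Bq, PE_zero]
end

noncomputable section
open Complex Matrix UpperHalfPlane MatrixGroups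
open Filter Topology

/-- The generator `[[1,0],[4,1]]`. -/
def Um : SL2Z := ⟨!![1, 0; 4, 1], by simp⟩
/-- A representative `[[1,0],[2,1]]` of the cusp `1/2`. -/
def Vm : SL2Z := ⟨!![1, 0; 2, 1], by simp⟩

/-- The stabilizer of a function. -/
def stabH (h : ℍ → ℂ) : Subgroup SL2Z where
  carrier := {γ | ∀ τ, h (γ • τ) = h τ}
  mul_mem' := by
    intro a b ha hb τ
    rw [mul_smul, ha, hb]
  one_mem' := fun τ => by rw [one_smul]
  inv_mem' := by
    intro a ha τ
    have := ha (a⁻¹ • τ)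
    rw [smul_inv_smul] at this
    exact this.symm

lemma cast_zmod4 (a r : ℤ) : ((a : ℤ) : ZMod 4) = (r : ZMod 4) ↔ (4:ℤ) ∣ a - r := by
  rw [eq_comm, ZMod.intCast_eq_intCast_iff_dvd_sub]; rfl

lemma inG_iff (γ : SL2Z) : InGamma1Upper 4 γ ↔
    (4:ℤ) ∣ γ 0 0 - 1 ∧ (4:ℤ) ∣ γ 1 0 ∧ (4:ℤ) ∣ γ 1 1 - 1 := by
  have h0 := cast_zmod4 (γ 0 0) 1
  have h1 := cast_zmod4 (γ 1 0) 0
  have h2 := cast_zmod4 (γ 1 1) 1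
  simp only [Int.cast_one, Int.cast_zero, sub_zero] at h0 h1 h2
  rw [InGamma1Upper, h0, h1, h2]

lemma inG_mem (γ : SL2Z) : γ ∈ CongruenceSubgroup.Gamma1 4 ↔ InGamma1Upper 4 γ := by
  rw [CongruenceSubgroup.Gamma1_mem, InGamma1Upper]; tauto

lemma det_eq (γ : SL2Z) : γ 0 0 * γ 1 1 - γ 0 1 * γ 1 0 = 1 := by
  have := γ.2; rwa [Matrix.det_fin_two] at this

lemma coe_Um : (Um : Matrix (Fin 2) (Fin 2) ℤ) = !![1, 0; 4, 1] := rfl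
lemma coe_Vm : (Vm : Matrix (Fin 2) (Fin 2) ℤ) = !![1, 0; 2, 1] := rfl
lemma coe_Um_inv : ((Um⁻¹ : SL2Z) : Matrix (Fin 2) (Fin 2) ℤ) = !![1, 0; -4, 1] := by
  rw [Matrix.SpecialLinearGroup.coe_inv, coe_Um, Matrix.adjugate_fin_two]; simp
lemma coe_Vm_inv : ((Vm⁻¹ : SL2Z) : Matrix (Fin 2) (Fin 2) ℤ) = !![1, 0; -2, 1] := by
  rw [Matrix.SpecialLinearGroup.coe_inv, coe_Vm, Matrix.adjugate_fin_two]; simp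
lemma coe_S_inv : ((ModularGroup.S⁻¹ : SL2Z) : Matrix (Fin 2) (Fin 2) ℤ) = !![0, 1; -1, 0] := by
  rw [Matrix.SpecialLinearGroup.coe_inv, ModularGroup.coe_S, Matrix.adjugate_fin_two]; simp

lemma T_mul00 (γ : SL2Z) : (ModularGroup.T * γ) 0 0 = γ 0 0 + γ 1 0 ∧
    (ModularGroup.T * γ) 1 0 = γ 1 0 ∧ (ModularGroup.T * γ) 1 1 = γ 1 1 := by
  rw [Matrix.SpecialLinearGroup.coe_mul, ModularGroup.coe_T]
  simp [Matrix.mul_apply, Fin.sum_univ_two]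
lemma Ti_mul00 (γ : SL2Z) : (ModularGroup.T⁻¹ * γ) 0 0 = γ 0 0 - γ 1 0 ∧
    (ModularGroup.T⁻¹ * γ) 1 0 = γ 1 0 ∧ (ModularGroup.T⁻¹ * γ) 1 1 = γ 1 1 := by
  rw [Matrix.SpecialLinearGroup.coe_mul, ModularGroup.coe_T_inv]
  simp [Matrix.mul_apply, Fin.sum_univ_two, sub_eq_add_neg]
lemma U_mul00 (γ : SL2Z) : (Um * γ) 0 0 = γ 0 0 ∧
    (Um * γ) 1 0 = 4 * γ 0 0 + γ 1 0 ∧ (Um * γ) 1 1 = 4 * γ 0 1 + γ 1 1 := by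
  rw [Matrix.SpecialLinearGroup.coe_mul, coe_Um]
  simp [Matrix.mul_apply, Fin.sum_univ_two]
lemma Ui_mul00 (γ : SL2Z) : (Um⁻¹ * γ) 0 0 = γ 0 0 ∧
    (Um⁻¹ * γ) 1 0 = -4 * γ 0 0 + γ 1 0 ∧ (Um⁻¹ * γ) 1 1 = -4 * γ 0 1 + γ 1 1 := by
  rw [Matrix.SpecialLinearGroup.coe_mul, coe_Um_inv]
  simp [Matrix.mul_apply, Fin.sum_univ_two]

lemma gen_aux (H : Subgroup SL2Z) (hT : ModularGroup.T ∈ H) (hU : Um ∈ H) :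
    ∀ (n : ℕ) (γ : SL2Z), (γ 0 0).natAbs + (γ 1 0).natAbs ≤ n →
      (4:ℤ) ∣ γ 0 0 - 1 → (4:ℤ) ∣ γ 1 0 → γ ∈ H := by
  intro n
  induction n with
  | zero =>
    intro γ hn ha hc
    omega
  | succ n ih =>
    intro γ hn ha hc
    by_cases hc0 : γ 1 0 = 0
    · have hd := det_eq γ
      rw [hc0, mul_zero, sub_zero] at hd
      have ha1 : γ 0 0 = 1 := by
        rcases Int.eq_one_or_neg_one_of_mul_eq_one hd with h | h
        · exact h
        · rw [h] at ha; omega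
      have hd1 : γ 1 1 = 1 := by rw [ha1] at hd; simpa using hd
      have : γ = ModularGroup.T ^ (γ 0 1) := by
        ext i j
        rw [ModularGroup.coe_T_zpow]
        fin_cases i <;> fin_cases j <;> simp [ha1, hd1, hc0]
      rw [this]; exact H.zpow_mem hT _
    · by_cases hlt : (γ 1 0).natAbs < 2 * (γ 0 0).natAbs
      · by_cases hs : (0 < γ 0 0 ↔ 0 < γ 1 0)
        · obtain ⟨e1, e2, e3⟩ := Ti_mul00 γ
          have : ModularGroup.T⁻¹ * γ ∈ H := ih _ (by rw [e1, e2]; omega) (by rw [e1]; omega)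
            (by rw [e2]; exact hc)
          exact (H.mul_mem_cancel_left (H.inv_mem hT)).1 this
        · obtain ⟨e1, e2, e3⟩ := T_mul00 γ
          have : ModularGroup.T * γ ∈ H := ih _ (by rw [e1, e2]; omega) (by rw [e1]; omega)
            (by rw [e2]; exact hc)
          exact (H.mul_mem_cancel_left hT).1 this
      · by_cases hs : (0 < γ 0 0 ↔ 0 < γ 1 0)
        · obtain ⟨e1, e2, e3⟩ := Ui_mul00 γ
          have : Um⁻¹ * γ ∈ H := ih _ (by rw [e1, e2]; omega) (by rw [e1]; omega)
            (by rw [e2]; omega)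
          exact (H.mul_mem_cancel_left (H.inv_mem hU)).1 this
        · obtain ⟨e1, e2, e3⟩ := U_mul00 γ
          have : Um * γ ∈ H := ih _ (by rw [e1, e2]; omega) (by rw [e1]; omega)
            (by rw [e2]; omega)
          exact (H.mul_mem_cancel_left hU).1 this

lemma inv_of_gens (h : ℍ → ℂ) (hT : ∀ τ, h (ModularGroup.T • τ) = h τ)
    (hU : ∀ τ, h (Um • τ) = h τ) (γ : SL2Z) (hγ : InGamma1Upper 4 γ) (τ : ℍ) :
    h (γ • τ) = h τ := by
  rw [inG_iff] at hγ
  exact gen_aux (stabH h) hT hU _ γ le_rfl hγ.1 hγ.2.1 τ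

lemma pm_lift (δ : SL2Z) (hc : (4:ℤ) ∣ δ 1 0) :
    InGamma1Upper 4 δ ∨ InGamma1Upper 4 (-δ) := by
  have hd := det_eq δ
  obtain ⟨k, hk⟩ := hc
  have hm : (δ 0 0 * δ 1 1) % 4 = 1 := by
    have : δ 0 0 * δ 1 1 = 1 + 4 * (δ 0 1 * k) := by rw [hk] at hd; linear_combination hd
    omega
  rw [inG_iff, inG_iff]
  simp only [Matrix.SpecialLinearGroup.coe_neg, Matrix.neg_apply]
  rw [Int.mul_emod] at hm
  have h1 : δ 0 0 % 4 = 0 ∨ δ 0 0 % 4 = 1 ∨ δ 0 0 % 4 = 2 ∨ δ 0 0 % 4 = 3 := by omega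
  have h2 : δ 1 1 % 4 = 0 ∨ δ 1 1 % 4 = 1 ∨ δ 1 1 % 4 = 2 ∨ δ 1 1 % 4 = 3 := by omega
  rcases h1 with h1 | h1 | h1 | h1 <;> rcases h2 with h2 | h2 | h2 | h2 <;>
    rw [h1, h2] at hm <;> first | (exfalso; revert hm; decide) | omega

lemma coset_aux (γ : SL2Z) : ∃ ρ : SL2Z, (ρ = 1 ∨ ρ = ModularGroup.S ∨ ρ = Vm) ∧ ∃ j : ℤ,
    (4:ℤ) ∣ (γ * (ρ * ModularGroup.T ^ j)⁻¹) 1 0 := by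
  have hd := det_eq γ
  have hc : γ 1 0 % 4 = 0 ∨ γ 1 0 % 4 = 2 ∨ γ 1 0 % 2 = 1 := by omega
  rcases hc with hc | hc | hc
  · exact ⟨1, Or.inl rfl, 0, by simpa using Int.dvd_of_emod_eq_zero hc⟩
  · refine ⟨Vm, Or.inr (Or.inr rfl), 0, ?_⟩
    have e : (γ * (Vm * ModularGroup.T ^ (0:ℤ))⁻¹) 1 0 = γ 1 0 - 2 * γ 1 1 := by
      rw [zpow_zero, mul_one, Matrix.SpecialLinearGroup.coe_mul, coe_Vm_inv]
      simp [Matrix.mul_apply, Fin.sum_univ_two]; ring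
    rw [e]
    have : γ 1 1 % 2 = 1 := by
      by_contra hne
      obtain ⟨k, hk⟩ : (2:ℤ) ∣ γ 1 1 := by omega
      obtain ⟨l, hl⟩ : (2:ℤ) ∣ γ 1 0 := by omega
      rw [hk, hl] at hd
      have : 2 * (γ 0 0 * k - γ 0 1 * l) = 1 := by linear_combination hd
      omega
    omega
  · refine ⟨ModularGroup.S, Or.inr (Or.inl rfl), γ 1 1 * γ 1 0, ?_⟩
    have e : (γ * (ModularGroup.S * ModularGroup.T ^ (γ 1 1 * γ 1 0))⁻¹) 1 0
        = γ 1 1 * (γ 1 0 * γ 1 0 - 1) := by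
      rw [_root_.mul_inv_rev, ← _root_.zpow_neg, Matrix.SpecialLinearGroup.coe_mul,
        Matrix.SpecialLinearGroup.coe_mul, coe_S_inv, ModularGroup.coe_T_zpow]
      simp [Matrix.mul_apply, Fin.sum_univ_two]; ring
    rw [e]
    obtain ⟨k, hk⟩ : ∃ k, γ 1 0 = 2 * k + 1 := ⟨γ 1 0 / 2, by omega⟩
    rw [hk]
    exact ⟨γ 1 1 * (k * k + k), by ring⟩

lemma coset_smul (γ : SL2Z) : ∃ ρ : SL2Z, (ρ = 1 ∨ ρ = ModularGroup.S ∨ ρ = Vm) ∧ ∃ j : ℤ,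
    ∃ δ : SL2Z, InGamma1Upper 4 δ ∧ ∀ τ : ℍ, γ • τ = δ • (ρ • (((j:ℝ) +ᵥ τ : ℍ))) := by
  obtain ⟨ρ, hρ, j, hj⟩ := coset_aux γ
  refine ⟨ρ, hρ, j, ?_⟩
  set δ := γ * (ρ * ModularGroup.T ^ j)⁻¹ with hδ
  have hγ : γ = δ * (ρ * ModularGroup.T ^ j) := by rw [hδ]; group
  have hs : ∀ τ : ℍ, γ • τ = δ • (ρ • (((j:ℝ) +ᵥ τ : ℍ))) := by
    intro τ
    rw [← UpperHalfPlane.modular_T_zpow_smul, ← mul_smul, ← mul_smul, mul_assoc, ← hγ]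
  rcases pm_lift δ hj with h | h
  · exact ⟨δ, h, hs⟩
  · refine ⟨-δ, h, fun τ => ?_⟩
    rw [hs, ModularGroup.SL_neg_smul]

lemma coset_fun {h : ℍ → ℂ} (hinv : ∀ γ, InGamma1Upper 4 γ → ∀ τ : ℍ, h (γ • τ) = h τ)
    (P : (ℍ → ℂ) → Prop) (hP : ∀ f (j : ℤ), P f → P (fun τ => f ((j:ℝ) +ᵥ τ)))
    (h1 : P h) (hS : P (fun τ => h (ModularGroup.S • τ))) (hV : P (fun τ => h (Vm • τ)))
    (γ : SL2Z) : P (fun τ => h (γ • τ)) := by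
  obtain ⟨ρ, hρ, j, δ, hδ, hs⟩ := coset_smul γ
  simp_rw [hs, hinv δ hδ]
  rcases hρ with rfl | rfl | rfl
  · simp_rw [one_smul]; exact hP h j h1
  · exact hP _ j hS
  · exact hP _ j hV
end

noncomputable section
open Complex Matrix UpperHalfPlane MatrixGroups
open Filter Topology
open scoped ModularForm Manifold

lemma asC_eq (h : ℍ → ℂ) {z : ℂ} (hz : 0 < z.im) : asComplexFun h z = h ⟨z, hz⟩ := by
  rw [asComplexFun, dif_pos hz]

lemma holo_iff (h : ℍ → ℂ) : IsHoloOnH h ↔ MDifferentiable 𝓘(ℂ) 𝓘(ℂ) h := by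
  rw [UpperHalfPlane.mdifferentiable_iff, IsHoloOnH]
  apply differentiableOn_congr
  intro z hz
  rw [asC_eq h hz, Function.comp_apply, UpperHalfPlane.ofComplex_apply_of_im_pos hz]

lemma liouville {h : ℍ → ℂ} (holo : IsHoloOnH h)
    (hinv : ∀ γ, InGamma1Upper 4 γ → ∀ τ : ℍ, h (γ • τ) = h τ)
    (hb : ∀ γ : SL2Z, IsBoundedAtImInfty (fun τ => h (γ • τ))) : ∃ c, ∀ τ, h τ = c := by
  have hsl : ∀ γ : SL2Z, (h ∣[(0:ℤ)] γ) = fun τ => h (γ • τ) := by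
    intro γ; ext τ
    rw [ModularForm.SL_slash_apply]; simp
  let f : ModularForm ((CongruenceSubgroup.Gamma1 4).map (Matrix.SpecialLinearGroup.mapGL ℝ)) 0 :=
    { toFun := h
      slash_action_eq' := by
        rintro _ ⟨γ, hγ, rfl⟩
        have := hsl γ
        rw [ModularForm.SL_slash] at this
        refine this.trans ?_
        ext τ
        exact hinv γ ((inG_mem γ).1 hγ) τ
      holo' := (holo_iff h).1 holo
      bdd_at_cusps' := by
        intro c hc
        rw [Subgroup.IsArithmetic.isCusp_iff_isCusp_SL2Z] at hc
        rw [OnePoint.isBoundedAt_iff_forall_SL2Z hc]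
        intro γ _
        rw [hsl]; exact hb γ }
  obtain ⟨c, hc⟩ := ModularForm.eq_const_of_weight_zero f
  exact ⟨c, fun τ => congrFun hc τ⟩
end

noncomputable section
open Complex Matrix UpperHalfPlane MatrixGroups
open Filter Topology Asymptotics
open scoped ModularForm Manifold

lemma coe_T_smul (τ : ℍ) : ((ModularGroup.T • τ : ℍ) : ℂ) = τ + 1 := by
  rw [UpperHalfPlane.coe_specialLinearGroup_apply, ModularGroup.coe_T]; simp
lemma coe_S_smul (τ : ℍ) : ((ModularGroup.S • τ : ℍ) : ℂ) = -1 / τ := by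
  rw [UpperHalfPlane.coe_specialLinearGroup_apply, ModularGroup.coe_S]; simp
lemma coe_U_smul (τ : ℍ) : ((Um • τ : ℍ) : ℂ) = τ / (4 * τ + 1) := by
  rw [UpperHalfPlane.coe_specialLinearGroup_apply, coe_Um]; simp
lemma coe_V_smul (τ : ℍ) : ((Vm • τ : ℍ) : ℂ) = τ / (2 * τ + 1) := by
  rw [UpperHalfPlane.coe_specialLinearGroup_apply, coe_Vm]; simp

lemma U_fricke {z : ℂ} (hz : 0 < z.im) : ∃ s : ℂ, 0 < s.im ∧ z = -1 / (4 * (s + 1)) ∧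
    z / (4 * z + 1) = -1 / (4 * s) := by
  have hz0 : z ≠ 0 := by rintro rfl; simp at hz
  have hz3 : 4 * z + 1 ≠ 0 := by
    intro h; have := congrArg Complex.im h; simp at this; exact hz.ne' this
  have him := im_neg_inv (im_four hz)
  refine ⟨-1 / (4 * z) - 1, by simpa using him, ?_, ?_⟩
  · rw [sub_add_cancel]; field_simp
  · have : 4 * (-1 / (4 * z) - 1) = -((4 * z + 1) / z) := by field_simp; ring
    rw [this, neg_div_neg_eq, one_div_div]

lemma Gf_U {z : ℂ} (hz : 0 < z.im) : Gf (z / (4 * z + 1)) = Gf z := by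
  obtain ⟨s, hs, h1, h2⟩ := U_fricke hz
  have hs1 : 0 < (s + 1).im := by simpa using hs
  rw [h2, h1, Gf_fricke hs, Gf_fricke hs1, Lf_add_one hs]
lemma Kf_U {z : ℂ} (hz : 0 < z.im) : Kf (z / (4 * z + 1)) = Kf z := by
  obtain ⟨s, hs, h1, h2⟩ := U_fricke hz
  have hs1 : 0 < (s + 1).im := by simpa using hs
  rw [h2, h1, Kf_fricke hs, Kf_fricke hs1, Kf_add_one]

lemma Gf_inv (γ : SL2Z) (hγ : InGamma1Upper 4 γ) (τ : ℍ) :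
    Gf ((γ • τ : ℍ) : ℂ) = Gf τ :=
  inv_of_gens (fun τ : ℍ => Gf τ) (fun τ => by rw [coe_T_smul, Gf_add_one τ.2])
    (fun τ => by rw [coe_U_smul, Gf_U τ.2]) γ hγ τ
lemma Kf_inv (γ : SL2Z) (hγ : InGamma1Upper 4 γ) (τ : ℍ) :
    Kf ((γ • τ : ℍ) : ℂ) = Kf τ :=
  inv_of_gens (fun τ : ℍ => Kf τ) (fun τ => by rw [coe_T_smul, Kf_add_one])
    (fun τ => by rw [coe_U_smul, Kf_U τ.2]) γ hγ τ

/-- The comparison function `exp (a * Im τ)`. -/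
def ex (a : ℝ) (τ : ℍ) : ℝ := Real.exp (a * τ.im)

lemma ex_pos (a : ℝ) (τ : ℍ) : 0 < ex a τ := Real.exp_pos _
lemma ex_mul (a b : ℝ) (τ : ℍ) : ex a τ * ex b τ = ex (a + b) τ := by
  rw [ex, ex, ex, ← Real.exp_add]; ring_nf
lemma ex_pow (a : ℝ) (n : ℕ) (τ : ℍ) : ex a τ ^ n = ex (n * a) τ := by
  rw [ex, ex, ← Real.exp_nat_mul]; ring_nf
lemma ex_div (a b : ℝ) (τ : ℍ) : ex a τ / ex b τ = ex (a - b) τ := by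
  rw [ex, ex, ex, ← Real.exp_sub]; ring_nf
lemma ex_inv (a : ℝ) (τ : ℍ) : (ex a τ)⁻¹ = ex (-a) τ := by
  rw [ex, ex, ← Real.exp_neg]; ring_nf
lemma ex_zero (τ : ℍ) : ex 0 τ = 1 := by simp [ex]
lemma ex_mono {a b : ℝ} (h : a ≤ b) (τ : ℍ) : ex a τ ≤ ex b τ :=
  Real.exp_le_exp.2 (mul_le_mul_of_nonneg_right h τ.im_pos.le)

lemma norm_e2pi (z : ℂ) : ‖e2pi z‖ = Real.exp (-2 * Real.pi * z.im) := by
  rw [e2pi, Complex.norm_exp]; congr 1; simp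

lemma tendsto_e2pi {c : ℝ} (hc : 0 < c) (r : ℝ) :
    Tendsto (fun τ : ℍ => e2pi (c * τ + r)) atImInfty (𝓝 0) := by
  rw [tendsto_zero_iff_norm_tendsto_zero]
  simp_rw [norm_e2pi]
  have h1 : Tendsto (fun τ : ℍ => τ.im) atImInfty atTop := tendsto_comap
  have : (fun τ : ℍ => Real.exp (-2 * Real.pi * ((c:ℂ) * τ + r).im))
      = fun τ : ℍ => Real.exp (-((2 * Real.pi * c) * τ.im)) := by
    ext τ; congr 1; simp; ring
  rw [this]
  exact Real.tendsto_exp_neg_atTop_nhds_zero.comp (h1.const_mul_atTop (by positivity))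

lemma tendsto_e2pi_self : Tendsto (fun τ : ℍ => e2pi τ) atImInfty (𝓝 0) := by
  simpa using tendsto_e2pi one_pos 0

lemma tendsto_PE {c : ℝ} (hc : 0 < c) (r : ℝ) :
    Tendsto (fun τ : ℍ => PE (e2pi (c * τ + r))) atImInfty (𝓝 1) := by
  have h1 := AnIn_PE_pow_Q 1 (by norm_num)
  simp only [pow_one] at h1
  have := h1.1.continuousAt.tendsto
  rw [PE_zero] at this
  exact this.comp (tendsto_e2pi hc r)

lemma theta_of_tendsto {f : ℍ → ℂ} {c : ℂ} (h : Tendsto f atImInfty (𝓝 c)) (hc : c ≠ 0) :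
    f =Θ[atImInfty] fun _ => (1:ℝ) :=
  ((isEquivalent_const_iff_tendsto hc).2 h).isTheta.trans
    (isTheta_const_const hc one_ne_zero)

lemma theta_E8 {c : ℝ} (hc : 0 < c) (r : ℝ) :
    (fun τ : ℍ => E8 (c * τ + r)) =Θ[atImInfty] ex (-(2 * Real.pi / 3) * c) := by
  simp_rw [E8_eq]
  have h1 : (fun τ : ℍ => Complex.exp (2 * Real.pi * Complex.I * (c * τ + r) / 3)) =Θ[atImInfty]
      ex (-(2 * Real.pi / 3) * c) := by
    have : ∀ τ : ℍ, ‖Complex.exp (2 * Real.pi * Complex.I * (c * τ + r) / 3)‖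
        = ‖ex (-(2 * Real.pi / 3) * c) τ‖ := by
      intro τ
      rw [Complex.norm_exp, Real.norm_of_nonneg (ex_pos _ _).le, ex]
      congr 1
      have : 2 * Real.pi * Complex.I * (c * τ + r) / 3
        = ((2 * Real.pi / 3 : ℝ) : ℂ) * (Complex.I * (c * τ + r)) := by push_cast; ring
      rw [this, Complex.re_ofReal_mul]; simp
      ring
    exact ⟨isBigO_of_le _ fun τ => (this τ).le, isBigO_of_le _ fun τ => (this τ).ge⟩
  have h2 : (fun τ : ℍ => PE (e2pi (c * τ + r)) ^ 8) =Θ[atImInfty] fun _ => (1:ℝ) := by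
    have ht := (tendsto_PE hc r).pow 8
    rw [one_pow] at ht
    exact theta_of_tendsto ht one_ne_zero
  simpa using h1.mul h2

lemma theta_congr {f : ℍ → ℂ} {g : ℍ → ℝ} {a : ℝ} (h : f =Θ[atImInfty] g)
    (e : ∀ τ, g τ = ex a τ) : f =Θ[atImInfty] ex a := by
  rwa [show g = ex a from funext e] at h

lemma theta_E8' {c : ℝ} (hc : 0 < c) {w : ℍ → ℂ} {r a : ℝ} (hw : ∀ τ : ℍ, w τ = c * τ + r)
    (ha : a = -(2 * Real.pi / 3) * c) :
    (fun τ : ℍ => E8 (w τ)) =Θ[atImInfty] ex a := by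
  simp_rw [hw]; rw [ha]; exact theta_E8 hc r

lemma theta_G : (fun τ : ℍ => Gf τ) =Θ[atImInfty] ex (2 * Real.pi) := by
  have h1 := theta_E8' (c := 1) one_pos (w := fun τ => τ) (r := 0) (by intro τ; simp) rfl
  have h2 := theta_E8' (c := 2) two_pos (w := fun τ => 2 * τ) (r := 0) (by intro τ; simp) rfl
  have h4 := theta_E8' (c := 4) four_pos (w := fun τ => 4 * τ) (r := 0) (by intro τ; simp) rfl
  refine theta_congr ((h2.pow 3).div (h1.mul (h4.pow 2))) fun τ => ?_
  simp only [ex_pow, ex_mul, ex_div]; congr 1; push_cast; ring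

lemma theta_K : (fun τ : ℍ => Kf τ) =Θ[atImInfty] ex (2 * Real.pi) := by
  have h1 := theta_E8' (c := 1) one_pos (w := fun τ => τ) (r := 0) (by intro τ; simp) rfl
  have h4 := theta_E8' (c := 4) four_pos (w := fun τ => 4 * τ) (r := 0) (by intro τ; simp) rfl
  refine theta_congr (h1.div h4) fun τ => ?_
  simp only [ex_div]; congr 1; ring

lemma theta_GV : (fun τ : ℍ => Gf ((Vm • τ : ℍ) : ℂ)) =Θ[atImInfty] ex (-2 * Real.pi) := by
  simp_rw [coe_V_smul]
  have e : (fun τ : ℍ => Gf ((τ:ℂ) / (2 * τ + 1))) = fun τ : ℍ => 256 * omg *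
      (E8 (2 * τ) ^ 3 / (E8 τ * E8 (τ + 1 / 2) ^ 2)) := by ext τ; rw [Gf_V τ.2]
  rw [e]
  have h1 := theta_E8' (c := 1) one_pos (w := fun τ => τ) (r := 0) (by intro τ; simp) rfl
  have h2 := theta_E8' (c := 2) two_pos (w := fun τ => 2 * τ) (r := 0) (by intro τ; simp) rfl
  have h5 := theta_E8' (c := 1) one_pos (w := fun τ => τ + 1 / 2) (r := 1 / 2)
    (by intro τ; simp) rfl
  have hc : (256 * omg : ℂ) ≠ 0 := mul_ne_zero (by norm_num) omg_ne
  rw [isTheta_const_mul_left hc]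
  refine theta_congr ((h2.pow 3).div (h1.mul (h5.pow 2))) fun τ => ?_
  simp only [ex_pow, ex_mul, ex_div]; congr 1; push_cast; ring

lemma theta_KV : (fun τ : ℍ => Kf ((Vm • τ : ℍ) : ℂ)) =Θ[atImInfty] ex 0 := by
  simp_rw [coe_V_smul]
  have e : (fun τ : ℍ => Kf ((τ:ℂ) / (2 * τ + 1))) = fun τ : ℍ => 16 * omg ^ 2 *
      (E8 τ / E8 (τ + 1 / 2)) := by ext τ; rw [Kf_V τ.2]
  rw [e]
  have h1 := theta_E8' (c := 1) one_pos (w := fun τ => τ) (r := 0) (by intro τ; simp) rfl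
  have h5 := theta_E8' (c := 1) one_pos (w := fun τ => τ + 1 / 2) (r := 1 / 2)
    (by intro τ; simp) rfl
  have hc : (16 * omg ^ 2 : ℂ) ≠ 0 := mul_ne_zero (by norm_num) (pow_ne_zero _ omg_ne)
  rw [isTheta_const_mul_left hc]
  refine theta_congr (h1.div h5) fun τ => ?_
  simp only [ex_div]; congr 1; ring

lemma im_quarter {z : ℂ} (hz : 0 < z.im) : 0 < (z / 4).im := by
  rw [show z / 4 = ((1 / 4 : ℝ) : ℂ) * z by push_cast; ring, Complex.im_ofReal_mul]; positivity

lemma GS_eq (τ : ℍ) : Gf ((ModularGroup.S • τ : ℍ) : ℂ) = 16 * Lf (τ / 4) := by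
  rw [coe_S_smul, ← Gf_fricke (im_quarter τ.2)]; congr 2; ring
lemma KS_eq (τ : ℍ) : Kf ((ModularGroup.S • τ : ℍ) : ℂ) = 256 / Kf (τ / 4) := by
  rw [coe_S_smul, ← Kf_fricke (im_quarter τ.2)]; congr 2; ring

lemma Lf_eq {z : ℂ} (hz : 0 < z.im) :
    Lf z = (PE (e2pi (2 * z)) ^ 3 / (PE (e2pi z) ^ 2 * PE (e2pi (4 * z)))) ^ 8 := by
  have p1 := PE_ne hz
  have p4 := PE_ne (im_four hz)
  rw [Lf, E8_eq, E8_eq, E8_eq]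
  have e2 : Complex.exp (2 * Real.pi * Complex.I * (2 * z) / 3)
      = Complex.exp (2 * Real.pi * Complex.I * z / 3) ^ 2 := by
    rw [← Complex.exp_nat_mul]; congr 1; push_cast; ring
  have e4 : Complex.exp (2 * Real.pi * Complex.I * (4 * z) / 3)
      = Complex.exp (2 * Real.pi * Complex.I * z / 3) ^ 4 := by
    rw [← Complex.exp_nat_mul]; congr 1; push_cast; ring
  rw [e2, e4]
  have hr : Complex.exp (2 * Real.pi * Complex.I * z / 3) ≠ 0 := Complex.exp_ne_zero _
  generalize PE (e2pi (2 * z)) = w2 at *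
  generalize PE (e2pi (4 * z)) = w4 at *
  generalize PE (e2pi z) = w1 at *
  generalize Complex.exp (2 * Real.pi * Complex.I * z / 3) = r at *
  field_simp

lemma tendsto_GS :
    Tendsto (fun τ : ℍ => Gf ((ModularGroup.S • τ : ℍ) : ℂ)) atImInfty (𝓝 16) := by
  have e : (fun τ : ℍ => Gf ((ModularGroup.S • τ : ℍ) : ℂ)) = fun τ : ℍ => 16 *
      (PE (e2pi (((1 / 2 : ℝ) : ℂ) * τ + (0:ℝ))) ^ 3 / (PE (e2pi (((1 / 4 : ℝ) : ℂ) * τ + (0:ℝ))) ^ 2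
        * PE (e2pi (((1 : ℝ) : ℂ) * τ + (0:ℝ))))) ^ 8 := by
    ext τ
    rw [GS_eq, Lf_eq (im_quarter τ.2)]
    congr 7
    · push_cast; ring
    · push_cast; ring
    · push_cast; ring
  rw [e]
  have h2 := tendsto_PE (c := 1 / 2) (by norm_num) 0
  have h1 := tendsto_PE (c := 1 / 4) (by norm_num) 0
  have h4 := tendsto_PE (c := 1) (by norm_num) 0
  have := (((h2.pow 3).div ((h1.pow 2).mul h4) (by norm_num)).pow 8).const_mul 16
  simpa using this

lemma theta_GS : (fun τ : ℍ => Gf ((ModularGroup.S • τ : ℍ) : ℂ)) =Θ[atImInfty] ex 0 := by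
  exact theta_congr (theta_of_tendsto tendsto_GS (by norm_num)) fun τ => (ex_zero τ).symm

lemma theta_KS :
    (fun τ : ℍ => Kf ((ModularGroup.S • τ : ℍ) : ℂ)) =Θ[atImInfty] ex (-(Real.pi / 2)) := by
  have e : (fun τ : ℍ => Kf ((ModularGroup.S • τ : ℍ) : ℂ)) = fun τ : ℍ => 256 *
      (E8 τ / E8 (τ / 4)) := by
    ext τ
    rw [KS_eq, Kf, ← mul_div_assoc, ← mul_div_assoc]
    rw [div_div_eq_mul_div, mul_div_cancel_left₀ _ (by norm_num : (4:ℂ) ≠ 0)]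
  rw [e, isTheta_const_mul_left (by norm_num)]
  have h1 := theta_E8' (c := 1) one_pos (w := fun τ => τ) (r := 0) (by intro τ; simp) rfl
  have h4 := theta_E8' (c := 1 / 4) (by norm_num) (w := fun τ => τ / 4) (r := 0)
    (by intro τ; push_cast; ring) rfl
  refine theta_congr (h1.div h4) fun τ => ?_
  simp only [ex_div]; congr 1; ring
end

noncomputable section
open Complex Matrix UpperHalfPlane MatrixGroups
open Filter Topology Asymptotics
open scoped ModularForm Manifold

lemma tendsto_vadd (r : ℝ) : Tendsto (fun τ : ℍ => (r +ᵥ τ : ℍ)) atImInfty atImInfty := by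
  rw [atImInfty, tendsto_comap_iff]
  have : UpperHalfPlane.im ∘ (fun τ : ℍ => (r +ᵥ τ : ℍ)) = UpperHalfPlane.im := by
    ext τ; simp
  rw [this]; exact tendsto_comap

lemma ex_vadd (a r : ℝ) (τ : ℍ) : ex a (r +ᵥ τ : ℍ) = ex a τ := by
  simp [ex]

lemma bigO_ex_vadd {f : ℍ → ℂ} {a : ℝ} (r : ℝ) (h : f =O[atImInfty] ex a) :
    (fun τ => f (r +ᵥ τ : ℍ)) =O[atImInfty] ex a := by
  have := h.comp_tendsto (tendsto_vadd r)
  rwa [show ex a ∘ (fun τ : ℍ => (r +ᵥ τ : ℍ)) = ex a from funext fun τ => ex_vadd a r τ] at this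

lemma ex_bigO {a b : ℝ} (h : a ≤ b) : ex a =O[atImInfty] ex b :=
  isBigO_of_le _ fun τ => by
    rw [Real.norm_of_nonneg (ex_pos _ _).le, Real.norm_of_nonneg (ex_pos _ _).le]
    exact ex_mono h τ

lemma bdd_iff (f : ℍ → ℂ) : IsBoundedAtImInfty f ↔ f =O[atImInfty] ex 0 := by
  rw [show ex 0 = (1 : ℍ → ℝ) from funext fun τ => ex_zero τ]; rfl

lemma bdd_of_coset {h : ℍ → ℂ} (hinv : ∀ γ, InGamma1Upper 4 γ → ∀ τ : ℍ, h (γ • τ) = h τ)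
    (h1 : h =O[atImInfty] ex 0) (hS : (fun τ => h (ModularGroup.S • τ)) =O[atImInfty] ex 0)
    (hV : (fun τ => h (Vm • τ)) =O[atImInfty] ex 0)
    (γ : SL2Z) : IsBoundedAtImInfty (fun τ => h (γ • τ)) := by
  rw [bdd_iff]
  exact coset_fun hinv (fun f => f =O[atImInfty] ex 0) (fun f j hf => bigO_ex_vadd j hf)
    h1 hS hV γ

lemma holo_of_diff {F : ℂ → ℂ} (h : ∀ z : ℂ, 0 < z.im → DifferentiableAt ℂ F z) :
    IsHoloOnH (fun τ => F τ) := by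
  intro z hz
  have : DifferentiableWithinAt ℂ F {z : ℂ | 0 < z.im} z := (h z hz).differentiableWithinAt
  refine this.congr (fun w hw => ?_) ?_
  · rw [asC_eq _ hw]
  · rw [asC_eq _ hz]

lemma G_sub_K_const : ∃ c : ℂ, ∀ τ : ℍ, Gf τ - Kf τ = c := by
  refine liouville (h := fun τ : ℍ => Gf τ - Kf τ)
    (holo_of_diff (F := fun z => Gf z - Kf z) fun z hz => (Gf_diff hz).sub (Kf_diff hz))
    (fun γ hγ τ => by rw [Gf_inv γ hγ, Kf_inv γ hγ]) (bdd_of_coset (h := fun τ : ℍ => Gf τ - Kf τ)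
      (fun γ hγ τ => by rw [Gf_inv γ hγ, Kf_inv γ hγ]) ?_ ?_ ?_)
  · obtain ⟨ψ, hψ, he⟩ := AnIn.divX (AnIn_Aq.1.sub AnIn_Bq.1)
      (by simp [AnIn_Aq.2, AnIn_Bq.2])
    have h1 : ∀ᶠ τ : ℍ in atImInfty, Gf τ - Kf τ = ψ (e2pi τ) := by
      filter_upwards [tendsto_e2pi_self.eventually he] with τ hτ
      rw [Gf_eq τ.2, Kf_eq τ.2, ← mul_sub, hτ, inv_mul_cancel_left₀ (e2pi_ne _)]
    have h2 : Tendsto (fun τ : ℍ => ψ (e2pi τ)) atImInfty (𝓝 (ψ 0)) :=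
      hψ.1.continuousAt.tendsto.comp tendsto_e2pi_self
    have h3 := h2.isBigO_one ℝ
    rw [show (fun _ : ℍ => (1:ℝ)) = ex 0 from funext fun τ => (ex_zero τ).symm] at h3
    exact h3.congr' (h1.mono fun τ h => h.symm) (EventuallyEq.refl _ _)
  · exact theta_GS.1.sub (theta_KS.1.trans (ex_bigO (by linarith [Real.pi_pos])))
  · exact (theta_GV.1.trans (ex_bigO (by linarith [Real.pi_pos]))).sub theta_KV.1

lemma ex_tendsto_zero {a : ℝ} (ha : a < 0) : Tendsto (ex a) atImInfty (𝓝 0) := by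
  have h1 : Tendsto (fun τ : ℍ => τ.im) atImInfty atTop := tendsto_comap
  exact Real.tendsto_exp_atBot.comp (h1.const_mul_atTop_of_neg ha)

lemma atImInfty_ne : (atImInfty : Filter ℍ).NeBot := inferInstance

lemma G_eq_K (τ : ℍ) : Gf τ = Kf τ + 16 := by
  obtain ⟨c, hc⟩ := G_sub_K_const
  have h1 : Tendsto (fun τ : ℍ => Kf ((ModularGroup.S • τ : ℍ) : ℂ)) atImInfty (𝓝 0) :=
    theta_KS.1.trans_tendsto (ex_tendsto_zero (by linarith [Real.pi_pos]))
  have h2 := tendsto_GS.sub h1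
  simp_rw [hc, sub_zero] at h2
  have : c = 16 := tendsto_nhds_unique tendsto_const_nhds h2
  linear_combination hc τ + this
end

noncomputable section
open Complex Matrix UpperHalfPlane MatrixGroups
open Filter Topology Asymptotics
open scoped ModularForm Manifold

/-- Good functions: a workable reformulation of `MemO14`. -/
structure Good (h : ℍ → ℂ) : Prop where
  holo : IsHoloOnH h
  inv : ∀ γ : SL2Z, InGamma1Upper 4 γ → ∀ τ : ℍ, h (γ • τ) = h τ
  growth : ∀ γ : SL2Z, ∃ M : ℝ, (fun τ : ℍ => h (γ • τ)) =O[atImInfty] ex M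
  rat : ∃ (N : ℕ) (φ : ℂ → ℂ), AnIn QC φ ∧
    ∀ᶠ τ : ℍ in atImInfty, h τ = ((e2pi τ)⁻¹) ^ N * φ (e2pi τ)

lemma asC_add (f g : ℍ → ℂ) : asComplexFun (fun τ => f τ + g τ) = asComplexFun f + asComplexFun g := by
  funext z; simp only [asComplexFun, Pi.add_apply]; split_ifs <;> simp

lemma asC_mul (f g : ℍ → ℂ) : asComplexFun (fun τ => f τ * g τ) = asComplexFun f * asComplexFun g := by
  funext z; simp only [asComplexFun, Pi.mul_apply]; split_ifs <;> simp

lemma Good.const (c : ℚ) : Good (fun _ => (c : ℂ)) where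
  holo := holo_of_diff (F := fun _ => (c : ℂ)) fun z _ => differentiableAt_const _
  inv _ _ _ := rfl
  growth γ := ⟨0, by
    rw [show ex 0 = (fun _ => (1 : ℝ)) from funext fun τ => ex_zero τ]
    exact isBigO_const_const _ one_ne_zero _⟩
  rat := ⟨0, fun _ => (c : ℂ), AnIn.const (mem_QC.2 ⟨c, rfl⟩), by simp⟩

lemma Good.add {f g : ℍ → ℂ} (hf : Good f) (hg : Good g) : Good (fun τ => f τ + g τ) where
  holo := by
    unfold IsHoloOnH; rw [asC_add]; exact hf.holo.add hg.holo
  inv γ hγ τ := by simp only [hf.inv γ hγ, hg.inv γ hγ]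
  growth γ := by
    obtain ⟨M, hM⟩ := hf.growth γ
    obtain ⟨M', hM'⟩ := hg.growth γ
    exact ⟨max M M', (hM.trans (ex_bigO (le_max_left _ _))).add
      (hM'.trans (ex_bigO (le_max_right _ _)))⟩
  rat := by
    obtain ⟨N, φ, hφ, h1⟩ := hf.rat
    obtain ⟨N', φ', hφ', h2⟩ := hg.rat
    refine ⟨N + N', fun z => z ^ N' * φ z + z ^ N * φ' z,
      ((AnIn.id.pow N').mul hφ).add ((AnIn.id.pow N).mul hφ'), ?_⟩
    filter_upwards [h1, h2] with τ h1 h2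
    rw [h1, h2]
    have h0 := e2pi_ne (τ : ℂ)
    simp only [inv_pow, pow_add]
    generalize e2pi (τ : ℂ) = w at *
    field_simp

lemma Good.mul {f g : ℍ → ℂ} (hf : Good f) (hg : Good g) : Good (fun τ => f τ * g τ) where
  holo := by
    unfold IsHoloOnH; rw [asC_mul]; exact hf.holo.mul hg.holo
  inv γ hγ τ := by simp only [hf.inv γ hγ, hg.inv γ hγ]
  growth γ := by
    obtain ⟨M, hM⟩ := hf.growth γ
    obtain ⟨M', hM'⟩ := hg.growth γ
    refine ⟨M + M', (hM.mul hM').congr_right fun τ => ?_⟩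
    rw [ex_mul]
  rat := by
    obtain ⟨N, φ, hφ, h1⟩ := hf.rat
    obtain ⟨N', φ', hφ', h2⟩ := hg.rat
    refine ⟨N + N', fun z => φ z * φ' z, hφ.mul hφ', ?_⟩
    filter_upwards [h1, h2] with τ h1 h2
    rw [h1, h2]; ring

lemma Good.pow {f : ℍ → ℂ} (hf : Good f) (n : ℕ) : Good (fun τ => f τ ^ n) := by
  induction n with
  | zero => simpa using Good.const 1
  | succ n ih => simpa only [pow_succ] using ih.mul hf

lemma growth_of {h : ℍ → ℂ} (hinv : ∀ γ, InGamma1Upper 4 γ → ∀ τ : ℍ, h (γ • τ) = h τ)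
    {a b c : ℝ}
    (h1 : h =O[atImInfty] ex a) (hS : (fun τ => h (ModularGroup.S • τ)) =O[atImInfty] ex b)
    (hV : (fun τ => h (Vm • τ)) =O[atImInfty] ex c)
    (γ : SL2Z) : ∃ M : ℝ, (fun τ => h (γ • τ)) =O[atImInfty] ex M :=
  coset_fun hinv (fun f => ∃ M : ℝ, f =O[atImInfty] ex M)
    (fun _ j ⟨M, hf⟩ => ⟨M, bigO_ex_vadd j hf⟩) ⟨a, h1⟩ ⟨b, hS⟩ ⟨c, hV⟩ γ

lemma theta_inv {f : ℍ → ℂ} {a : ℝ} (h : f =Θ[atImInfty] ex a) :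
    (fun τ => (f τ)⁻¹) =O[atImInfty] ex (-a) := by
  refine h.inv.1.congr_right fun τ => ?_
  rw [ex_inv]

lemma Good_G : Good (fun τ : ℍ => Gf τ) where
  holo := holo_of_diff fun z hz => Gf_diff hz
  inv γ hγ τ := Gf_inv γ hγ τ
  growth := growth_of (h := fun τ : ℍ => Gf τ) (fun γ hγ τ => Gf_inv γ hγ τ) theta_G.1 theta_GS.1 theta_GV.1
  rat := ⟨1, Aq, AnIn_Aq.1, Eventually.of_forall fun τ => by rw [pow_one]; exact Gf_eq τ.2⟩

lemma Good_K : Good (fun τ : ℍ => Kf τ) where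
  holo := holo_of_diff fun z hz => Kf_diff hz
  inv γ hγ τ := Kf_inv γ hγ τ
  growth := growth_of (h := fun τ : ℍ => Kf τ) (fun γ hγ τ => Kf_inv γ hγ τ) theta_K.1 theta_KS.1 theta_KV.1
  rat := ⟨1, Bq, AnIn_Bq.1, Eventually.of_forall fun τ => by rw [pow_one]; exact Kf_eq τ.2⟩

lemma Good_Ginv : Good (fun τ : ℍ => (Gf τ)⁻¹) where
  holo := holo_of_diff (F := fun z => (Gf z)⁻¹) fun z hz => (Gf_diff hz).inv (Gf_ne hz)
  inv γ hγ τ := by rw [Gf_inv γ hγ τ]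
  growth := growth_of (h := fun τ : ℍ => (Gf τ)⁻¹) (fun γ hγ τ => by rw [Gf_inv γ hγ τ])
    (theta_inv theta_G) (theta_inv theta_GS) (theta_inv theta_GV)
  rat := ⟨0, fun z => z * (Aq z)⁻¹, AnIn.id.mul (AnIn_Aq.1.inv (by rw [AnIn_Aq.2]; exact one_ne_zero)),
    Eventually.of_forall fun τ => by
      rw [Gf_eq τ.2, pow_zero, one_mul, mul_inv, inv_inv]⟩

lemma Good_Kinv : Good (fun τ : ℍ => (Kf τ)⁻¹) where
  holo := holo_of_diff (F := fun z => (Kf z)⁻¹) fun z hz => (Kf_diff hz).inv (Kf_ne hz)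
  inv γ hγ τ := by rw [Kf_inv γ hγ τ]
  growth := growth_of (h := fun τ : ℍ => (Kf τ)⁻¹) (fun γ hγ τ => by rw [Kf_inv γ hγ τ])
    (theta_inv theta_K) (theta_inv theta_KS) (theta_inv theta_KV)
  rat := ⟨0, fun z => z * (Bq z)⁻¹, AnIn.id.mul (AnIn_Bq.1.inv (by rw [AnIn_Bq.2]; exact one_ne_zero)),
    Eventually.of_forall fun τ => by
      rw [Kf_eq τ.2, pow_zero, one_mul, mul_inv, inv_inv]⟩

end

noncomputable section
open Complex Matrix UpperHalfPlane MatrixGroups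
open Filter Topology Asymptotics
open scoped ModularForm Manifold

lemma qpow_eq (τ : ℍ) (k : ℤ) (N : ℕ) : qpow τ ((k : ℂ) / (N : ℂ)) = e2pi ((τ : ℂ) / N) ^ k := by
  rw [e2pi, ← Complex.exp_int_mul, qpow]
  congr 1; ring

lemma eventually_im (A : ℝ) : ∀ᶠ τ : ℍ in atImInfty, A < τ.im :=
  (tendsto_comap (f := UpperHalfPlane.im)).eventually (eventually_gt_atTop A)

lemma norm_e2pi_div (τ : ℍ) (N : ℕ) : ‖e2pi ((τ : ℂ) / N)‖ = Real.exp (-2 * Real.pi * (τ.im / N)) := by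
  rw [norm_e2pi, Complex.div_natCast_im]; rfl

lemma cusp_growth {f : ℍ → ℂ} (h : CuspExp 4 f) : ∃ M : ℝ, f =O[atImInfty] ex M := by
  obtain ⟨n₀, c, A, hA⟩ := h
  have hf : ∀ τ : ℍ, A < τ.im → f τ = e2pi ((τ : ℂ) / (4 : ℕ)) ^ n₀ *
      ∑' n : ℕ, c (n₀ + (n : ℤ)) * e2pi ((τ : ℂ) / (4 : ℕ)) ^ n := by
    intro τ hτ
    rw [hA τ hτ, ← tsum_mul_left]
    refine tsum_congr fun n => ?_
    rw [qpow_eq, zpow_add₀ (e2pi_ne _), zpow_natCast]; ring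
  by_cases hs : ∃ τ : ℍ, Summable fun n : ℕ => c (n₀ + (n : ℤ)) * e2pi ((τ : ℂ) / (4 : ℕ)) ^ n
  · obtain ⟨τ₁, hs⟩ := hs
    have hs' := hs.norm
    refine ⟨-(Real.pi / 2) * n₀, IsBigO.of_bound
      (∑' n : ℕ, ‖c (n₀ + (n : ℤ)) * e2pi ((τ₁ : ℂ) / (4 : ℕ)) ^ n‖) ?_⟩
    filter_upwards [eventually_im A, eventually_im τ₁.im] with τ h1 h2
    rw [hf τ h1, norm_mul, mul_comm]
    refine mul_le_mul (tsum_of_norm_bounded hs'.hasSum fun n => ?_) (le_of_eq ?_) (norm_nonneg _)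
      (tsum_nonneg fun n => norm_nonneg _)
    · rw [norm_mul, norm_mul, norm_pow, norm_pow]
      refine mul_le_mul_of_nonneg_left (pow_le_pow_left₀ (norm_nonneg _) ?_ _) (norm_nonneg _)
      rw [norm_e2pi_div, norm_e2pi_div, Real.exp_le_exp]
      push_cast
      nlinarith [Real.pi_pos]
    · rw [norm_zpow, norm_e2pi_div, ← Real.rpow_intCast, ← Real.exp_mul, Real.norm_of_nonneg (ex_pos _ _).le, ex]
      congr 1; push_cast; ring
  · refine ⟨0, (isBigO_zero _ _).congr' ?_ (EventuallyEq.refl _ _)⟩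
    filter_upwards [eventually_im A] with τ hτ
    rw [hf τ hτ, tsum_eq_zero_of_not_summable (fun h => hs ⟨τ, h⟩), mul_zero]

lemma rat_of {f : ℍ → ℂ} (h : RatQExp 1 f) : ∃ (N : ℕ) (φ : ℂ → ℂ), AnIn QC φ ∧
    ∀ᶠ τ : ℍ in atImInfty, f τ = ((e2pi τ)⁻¹) ^ N * φ (e2pi τ) := by
  obtain ⟨n₀, c, A, hA⟩ := h
  have hf : ∀ τ : ℍ, A < τ.im → f τ = e2pi τ ^ n₀ *
      ∑' n : ℕ, (c (n₀ + (n : ℤ)) : ℂ) * e2pi τ ^ n := by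
    intro τ hτ
    rw [hA τ hτ, ← tsum_mul_left]
    refine tsum_congr fun n => ?_
    rw [qpow_eq, zpow_add₀ (e2pi_ne _), zpow_natCast]; push_cast; rw [div_one]; ring
  by_cases hs : ∃ τ : ℍ, Summable fun n : ℕ => (c (n₀ + (n : ℤ)) : ℂ) * e2pi τ ^ n
  · obtain ⟨τ₁, hs⟩ := hs
    have hs' := hs.norm
    simp only [norm_mul, norm_pow] at hs'
    have hφ := AnIn_of_hasSum (c := fun n : ℕ => c (n₀ + (n : ℤ))) (norm_pos_iff.2 (e2pi_ne τ₁)) hs'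
    refine ⟨n₀.natAbs, _, (AnIn.id.pow (n₀ + n₀.natAbs).toNat).mul hφ, ?_⟩
    filter_upwards [eventually_im A] with τ hτ
    rw [hf τ hτ, ← mul_assoc]
    congr 1
    rw [inv_pow, ← zpow_natCast, ← zpow_natCast, ← _root_.zpow_neg, ← zpow_add₀ (e2pi_ne _)]
    congr 1
    omega
  · refine ⟨0, fun _ => 0, AnIn.const (zero_mem _), ?_⟩
    filter_upwards [eventually_im A] with τ hτ
    rw [hf τ hτ, tsum_eq_zero_of_not_summable (fun h => hs ⟨τ, h⟩), mul_zero, mul_zero]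

lemma Good_of_mem {h : ℍ → ℂ} (hm : MemO14 h) : Good h where
  holo := hm.2
  inv := hm.1.modular
  growth γ := cusp_growth (hm.1.cusp γ)
  rat := rat_of hm.1.ratQ

lemma ratQ_of {h : ℍ → ℂ} (hg : Good h) : RatQExp 1 h := by
  obtain ⟨N, φ, hφ, he⟩ := hg.rat
  obtain ⟨c, hc⟩ := hφ.hasSum
  obtain ⟨A, hA⟩ := (UpperHalfPlane.atImInfty_mem _).1 (he.and (tendsto_e2pi_self.eventually hc))
  refine ⟨-(N : ℤ), fun k => c (k + N).toNat, A, fun τ hτ => ?_⟩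
  obtain ⟨h1, h2⟩ := hA τ hτ.le
  rw [h1, ← h2.tsum_eq, ← tsum_mul_left]
  refine tsum_congr fun n => ?_
  rw [qpow_eq, zpow_add₀ (e2pi_ne _), zpow_natCast, _root_.zpow_neg, zpow_natCast, inv_pow]
  beta_reduce
  rw [show (-(N : ℤ) + (n : ℤ) + (N : ℤ)).toNat = n by omega]
  push_cast; rw [div_one]; ring

lemma holo_smul {h : ℍ → ℂ} (hh : IsHoloOnH h) (γ : SL2Z) :
    IsHoloOnH (fun τ => h (γ • τ)) := by
  rw [holo_iff] at *
  have := mdifferentiable_smul (g := (γ : GL (Fin 2) ℝ)) (by simp)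
  exact hh.comp this

lemma periodic_four {h : ℍ → ℂ} (hinv : ∀ γ : SL2Z, InGamma1Upper 4 γ → ∀ τ : ℍ, h (γ • τ) = h τ)
    (γ : SL2Z) (τ : ℍ) : h (γ • ((4 : ℝ) +ᵥ τ : ℍ)) = h (γ • τ) := by
  have h1 : ((4 : ℝ) +ᵥ τ : ℍ) = (ModularGroup.T ^ (4 : ℤ)) • τ := by
    rw [modular_T_zpow_smul]; norm_num
  rw [h1, ← hinv (γ * ModularGroup.T ^ (4 : ℤ) * γ⁻¹) ?_ (γ • τ)]
  · simp only [mul_smul, inv_smul_smul]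
  · rw [inG_iff]
    have hd := det_eq γ
    have hT : (ModularGroup.T ^ (4 : ℤ)).1 = !![1, 4; 0, 1] := by
      simpa using ModularGroup.coe_T_zpow 4
    have e : (γ * ModularGroup.T ^ (4 : ℤ) * γ⁻¹).1 =
      (γ.1 * !![1, 4; 0, 1] * γ.1.adjugate : Matrix (Fin 2) (Fin 2) ℤ) := by
      rw [Matrix.SpecialLinearGroup.coe_mul, Matrix.SpecialLinearGroup.coe_mul, hT,
        Matrix.SpecialLinearGroup.coe_inv]
    change 4 ∣ (γ * ModularGroup.T ^ (4 : ℤ) * γ⁻¹).1 0 0 - 1 ∧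
      4 ∣ (γ * ModularGroup.T ^ (4 : ℤ) * γ⁻¹).1 1 0 ∧
      4 ∣ (γ * ModularGroup.T ^ (4 : ℤ) * γ⁻¹).1 1 1 - 1
    rw [e]
    simp only [Matrix.adjugate_fin_two, Matrix.mul_apply, Fin.sum_univ_two]
    simp
    refine ⟨⟨-(γ.1 0 0 * γ.1 1 0), ?_⟩, ⟨-(γ.1 1 0 * γ.1 1 0), ?_⟩, ⟨γ.1 0 0 * γ.1 1 0, ?_⟩⟩
    · linear_combination hd
    · ring
    · linear_combination hd

lemma cusp_of {h : ℍ → ℂ} (hg : Good h) (γ : SL2Z) : CuspExp 4 (fun τ => h (γ • τ)) := by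
  obtain ⟨M, hM⟩ := hg.growth γ
  obtain ⟨N, hN⟩ := exists_nat_ge (M / (Real.pi / 2))
  have hN' : M ≤ N * (Real.pi / 2) := by
    rwa [div_le_iff₀ (by positivity)] at hN
  set F : ℍ → ℂ := fun τ => h (γ • τ) * e2pi ((τ : ℂ) / (4 : ℕ)) ^ N with hF
  have hp : ∀ τ : ℍ, F ((4 : ℝ) +ᵥ τ : ℍ) = F τ := by
    intro τ
    rw [hF]
    beta_reduce
    rw [periodic_four hg.inv]
    congr 2
    rw [UpperHalfPlane.coe_vadd, show (((4 : ℝ) : ℂ) + (τ : ℂ)) / ((4 : ℕ) : ℂ) = (τ : ℂ) / (4 : ℕ) + 1 by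
      push_cast; ring]
    rw [e2pi_add_one]
  have hper : Function.Periodic (F ∘ ofComplex) ((4 : ℝ) : ℂ) := by
    intro w
    by_cases hw : 0 < w.im
    · have h4 : 0 < (w + ((4 : ℝ) : ℂ)).im := by simpa using hw
      simp only [Function.comp_apply, ofComplex_apply_of_im_pos h4, ofComplex_apply_of_im_pos hw]
      rw [← hp ⟨w, hw⟩]
      congr 1
      ext
      simp [add_comm]
    · have h4 : (w + ((4 : ℝ) : ℂ)).im ≤ 0 := by simpa using hw
      simp only [Function.comp_apply, ofComplex_apply_eq_of_im_nonpos h4 (not_lt.1 hw)]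
  have hhol : MDifferentiable 𝓘(ℂ) 𝓘(ℂ) F := by
    rw [← holo_iff]
    unfold IsHoloOnH
    rw [hF, asC_mul]
    refine (holo_smul hg.holo γ).mul
      (holo_of_diff (F := fun z => e2pi (z / (4 : ℕ)) ^ N) fun z _ => ?_)
    unfold e2pi
    fun_prop
  have hbd : IsBoundedAtImInfty F := by
    rw [bdd_iff]
    have h2 : (fun τ : ℍ => e2pi ((τ : ℂ) / (4 : ℕ)) ^ N) =O[atImInfty] ex (-(N * (Real.pi / 2))) := by
      refine isBigO_of_le _ fun τ => le_of_eq ?_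
      rw [norm_pow, norm_e2pi_div, ← Real.exp_nat_mul, Real.norm_of_nonneg (ex_pos _ _).le, ex]
      congr 1; push_cast; ring
    have h3 : (fun τ : ℍ => ex M τ * ex (-(N * (Real.pi / 2))) τ) =O[atImInfty] ex 0 :=
      (ex_bigO (show M + -(N * (Real.pi / 2)) ≤ 0 by linarith)).congr_left
        fun τ => (ex_mul _ _ _).symm
    exact (hM.mul h2).trans h3
  refine ⟨-(N : ℤ), fun k => (qExpansion 4 F).coeff (k + N).toNat, 0, fun τ _ => ?_⟩
  have hs := hasSum_qExpansion (by norm_num) hper hhol hbd τ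
  have hq : Function.Periodic.qParam 4 (τ : ℂ) = e2pi ((τ : ℂ) / (4 : ℕ)) := by
    rw [Function.Periodic.qParam, e2pi]; congr 1; push_cast; ring
  rw [hq] at hs
  have hw := e2pi_ne ((τ : ℂ) / (4 : ℕ))
  have h1 : h (γ • τ) = (e2pi ((τ : ℂ) / (4 : ℕ)) ^ N)⁻¹ * F τ := by
    rw [hF]; beta_reduce
    rw [mul_comm (h _), inv_mul_cancel_left₀ (pow_ne_zero _ hw)]
  beta_reduce
  rw [h1, ← hs.tsum_eq, ← tsum_mul_left]
  refine tsum_congr fun n => ?_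
  rw [qpow_eq, zpow_add₀ hw, zpow_natCast, _root_.zpow_neg, zpow_natCast, smul_eq_mul]
  beta_reduce
  rw [show (-(N : ℤ) + (n : ℤ) + (N : ℤ)).toNat = n by omega]
  ring

lemma mem_of_Good {h : ℍ → ℂ} (hg : Good h) : MemO14 h :=
  ⟨⟨fun _ hz => (hg.holo.analyticAt
      ((isOpen_lt continuous_const Complex.continuous_im).mem_nhds hz)).meromorphicAt,
    hg.inv, cusp_of hg, ratQ_of hg⟩, hg.holo⟩

end

noncomputable section
open Complex Matrix UpperHalfPlane MatrixGroups
open Filter Topology Asymptotics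
open scoped ModularForm Manifold

lemma bigO_pow_zero {f : ℍ → ℂ} {a : ℝ} (hf : f =O[atImInfty] ex a) (n : ℕ) :
    (fun τ => f τ ^ n) =O[atImInfty] ex (n * a) := by
  exact (hf.pow n).congr_right fun τ => ex_pow a n τ

lemma bigO_mul_ex {f g : ℍ → ℂ} {a b : ℝ} (hf : f =O[atImInfty] ex a) (hg : g =O[atImInfty] ex b) :
    (fun τ => f τ * g τ) =O[atImInfty] ex (a + b) :=
  (hf.mul hg).congr_right fun τ => ex_mul a b τ

lemma AnIn_tendsto {φ : ℂ → ℂ} (hφ : AnIn QC φ) :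
    Tendsto (fun τ : ℍ => φ (e2pi τ)) atImInfty (𝓝 (φ 0)) :=
  hφ.1.continuousAt.tendsto.comp tendsto_e2pi_self

lemma AnIn_zero_rat {φ : ℂ → ℂ} (hφ : AnIn QC φ) : ∃ c : ℚ, (c : ℂ) = φ 0 := by
  have := hφ.2 0
  rw [iteratedDeriv_zero] at this
  exact mem_QC.1 this

lemma reduce (N : ℕ) : ∀ (φ : ℂ → ℂ) (H : ℍ → ℂ), Good H →
    (fun τ => H (ModularGroup.S • τ)) =O[atImInfty] ex 0 →
    (fun τ => H (Vm • τ)) =O[atImInfty] ex 0 → AnIn QC φ →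
    (∀ᶠ τ : ℍ in atImInfty, H τ = ((e2pi τ)⁻¹) ^ N * φ (e2pi τ)) →
    ∃ p : Polynomial ℚ, ∀ τ : ℍ, H τ = Polynomial.aeval (Gf τ) p := by
  induction N with
  | zero =>
    intro φ H hH hS hV hφ he
    have ht : Tendsto H atImInfty (𝓝 (φ 0)) := by
      refine (AnIn_tendsto hφ).congr' ?_
      filter_upwards [he] with τ hτ
      rw [hτ, pow_zero, one_mul]
    have hb : H =O[atImInfty] ex 0 := by
      have h3 := ht.isBigO_one ℝ
      rwa [show (fun _ : ℍ => (1:ℝ)) = ex 0 from funext fun τ => (ex_zero τ).symm] at h3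
    obtain ⟨c, hc⟩ := liouville hH.holo hH.inv (bdd_of_coset hH.inv hb hS hV)
    obtain ⟨r, hr⟩ := AnIn_zero_rat hφ
    have hcr : c = φ 0 := by
      have : Tendsto H atImInfty (𝓝 c) := by
        rw [show H = fun _ => c from funext hc]; exact tendsto_const_nhds
      exact tendsto_nhds_unique this ht
    exact ⟨Polynomial.C r, fun τ => by rw [hc τ, hcr, ← hr, Polynomial.aeval_C]; simp⟩
  | succ N ih =>
    intro φ H hH hS hV hφ he
    obtain ⟨c, hc⟩ := AnIn_zero_rat hφ
    have hcQ : (c : ℂ) ∈ QC := mem_QC.2 ⟨c, rfl⟩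
    obtain ⟨ψ, hψ, hψe⟩ := AnIn.divX (hφ.sub ((AnIn.const hcQ).mul (AnIn_Aq.1.pow (N + 1))))
      (by simp [AnIn_Aq.2, hc])
    have hG : Good (fun τ : ℍ => H τ + ((-c : ℚ) : ℂ) * Gf τ ^ (N + 1)) :=
      hH.add ((Good.const (-c)).mul (Good_G.pow (N + 1)))
    have hcO : (fun _ : ℍ => ((-c : ℚ) : ℂ)) =O[atImInfty] ex 0 := by
      rw [show ex 0 = (fun _ => (1 : ℝ)) from funext fun τ => ex_zero τ]
      exact isBigO_const_const _ one_ne_zero _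
    refine Exists.elim (ih ψ _ hG ?_ ?_ hψ ?_) ?_
    rotate_left 3
    · intro p hp
      refine ⟨p + Polynomial.C c * Polynomial.X ^ (N + 1), fun τ => ?_⟩
      rw [map_add, ← hp τ]
      simp
    · refine hS.add ?_
      have := bigO_mul_ex hcO (bigO_pow_zero theta_GS.1 (N + 1))
      simpa using this
    · refine hV.add ((bigO_mul_ex hcO (bigO_pow_zero theta_GV.1 (N + 1))).trans (ex_bigO ?_))
      have : (0 : ℝ) ≤ ((N + 1 : ℕ) : ℝ) * (2 * Real.pi) := by positivity
      linarith
    · filter_upwards [he, tendsto_e2pi_self.eventually hψe] with τ h1 h2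
      have hw := e2pi_ne (τ : ℂ)
      have h3 : ((e2pi (τ : ℂ))⁻¹) ^ N * ψ (e2pi τ) =
          ((e2pi (τ : ℂ))⁻¹) ^ (N + 1) * (e2pi τ * ψ (e2pi τ)) := by
        rw [pow_succ]; field_simp
      rw [h3, ← h2, h1, Gf_eq τ.2]
      push_cast
      rw [mul_pow]; ring

lemma exists_rep {h : ℍ → ℂ} (hg : Good h) : ∃ (p : Polynomial ℚ) (a b : ℕ), ∀ τ : ℍ,
    h τ = Polynomial.aeval (Gf τ) p * (Gf τ)⁻¹ ^ a * (Kf τ)⁻¹ ^ b := by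
  obtain ⟨MS, hMS⟩ := hg.growth ModularGroup.S
  obtain ⟨MV, hMV⟩ := hg.growth Vm
  have hpi := Real.pi_pos
  obtain ⟨a, ha⟩ := exists_nat_ge (MV / (2 * Real.pi))
  obtain ⟨b, hb⟩ := exists_nat_ge (MS / (Real.pi / 2))
  rw [div_le_iff₀ (by positivity)] at ha hb
  have hF : Good (fun τ : ℍ => h τ * Gf τ ^ a * Kf τ ^ b) :=
    (hg.mul (Good_G.pow a)).mul (Good_K.pow b)
  obtain ⟨N, φ, hφ, he⟩ := hF.rat
  refine Exists.elim (reduce N φ _ hF ?_ ?_ hφ he) ?_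
  rotate_left 2
  · intro p hp
    refine ⟨p, a, b, fun τ => ?_⟩
    rw [← hp τ]
    have h1 : Gf τ ≠ 0 := Gf_ne τ.2
    have h2 : Kf τ ≠ 0 := Kf_ne τ.2
    generalize Gf (τ : ℂ) = x at *
    generalize Kf (τ : ℂ) = y at *
    rw [inv_pow, inv_pow]
    field_simp
  · refine (bigO_mul_ex (bigO_mul_ex hMS (bigO_pow_zero theta_GS.1 a))
      (bigO_pow_zero theta_KS.1 b)).trans (ex_bigO ?_)
    linarith
  · refine (bigO_mul_ex (bigO_mul_ex hMV (bigO_pow_zero theta_GV.1 a))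
      (bigO_pow_zero theta_KV.1 b)).trans (ex_bigO ?_)
    linarith

lemma g14_sub (τ : ℍ) : g14 τ - 16 = Kf τ := by
  rw [g14_eq, G_eq_K]; ring

lemma Good_poly (P : MvPolynomial (Fin 3) ℚ) :
    Good (fun τ => MvPolynomial.aeval ![g14 τ, (g14 τ)⁻¹, (g14 τ - 16)⁻¹] P) := by
  induction P using MvPolynomial.induction_on with
  | C r => simpa using Good.const r
  | add p q hp hq => simpa only [map_add] using hp.add hq
  | mul_X p i hp =>
    simp only [map_mul, MvPolynomial.aeval_X]
    refine hp.mul ?_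
    fin_cases i
    · simpa [g14_eq] using Good_G
    · simpa [g14_eq] using Good_Ginv
    · simpa [g14_sub] using Good_Kinv

end

/-- `O_{1,4}(ℚ) = ℚ[g_{1,4}, g_{1,4}⁻¹, (g_{1,4} - 16)⁻¹]`. -/
theorem O14_eq_polynomial_ring (h : ℍ → ℂ) :
    MemO14 h ↔ ∃ P : MvPolynomial (Fin 3) ℚ,
      h = fun τ => MvPolynomial.aeval ![g14 τ, (g14 τ)⁻¹, (g14 τ - 16)⁻¹] P := by
  constructor
  · intro hm
    obtain ⟨p, a, b, hp⟩ := exists_rep (Good_of_mem hm)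
    refine ⟨Polynomial.aeval (MvPolynomial.X 0) p * MvPolynomial.X 1 ^ a *
      MvPolynomial.X 2 ^ b, ?_⟩
    funext τ
    rw [hp τ, map_mul, map_mul, ← Polynomial.aeval_algHom_apply]
    simp [g14_eq, g14_sub, ← G_eq_K]
    simp [G_eq_K]
  · rintro ⟨P, rfl⟩
    exact mem_of_Good (Good_poly P)

end
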